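/- There is a constant C > 0 such that the following holds for every odd prime p. Let ε ∈ (0,1), let ℓ,q ≥ 0 be integers, and let 𝓑 = (L,Q) be a quadratic factor on G = 𝔽_p^n of complexity (ℓ,q) and rank at least C(ℓ+q+log_p(ε^(−1))). Then for every b ∈ 𝔽_p^ℓ × 𝔽_p^q, every d ∈ (𝔽_p^ℓ × 𝔽_p^q)³ × (𝔽_p^q)³ with Σ(d) = b, and every function f : G → [−1,1], one has |(‖f‖_{U³(d)}^{TW})^8 − (‖f‖_{U³(b)}^P)^8| ≤ ε. -/

import Mathlib

open scoped BigOperators symmDiff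
open Finset

attribute [local instance] Classical.propDecidable

namespace PaperTS

noncomputable section

/-- The group `𝔽_p^n`, written additively. -/
abbrev Vec (p n : ℕ) := Fin n → ZMod p

/-- Dot product on `𝔽_p^n`. -/
def dot {p n : ℕ} (x y : Vec p n) : ZMod p := ∑ i, x i * y i

/-- A quadratic factor of complexity `(ℓ, q)` on `𝔽_p^n`: a set of `ℓ` linearly independent
vectors together with a set of `q` pairwise distinct symmetric matrices. -/
structure QuadFactor (p n ℓ q : ℕ) where
  L : Fin ℓ → Vec p n
  Q : Fin q → Matrix (Fin n) (Fin n) (ZMod p)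
  linIndep : LinearIndependent (ZMod p) L
  symm : ∀ j, (Q j).IsSymm
  inj : Function.Injective Q

/-- Labels of atoms of a quadratic factor of complexity `(ℓ, q)`. -/
abbrev Label (p ℓ q : ℕ) := (Fin ℓ → ZMod p) × (Fin q → ZMod p)

namespace QuadFactor

variable {p n ℓ q : ℕ}

/-- The linear form `β_L`. -/
def betaL (B : QuadFactor p n ℓ q) (x : Vec p n) : Fin ℓ → ZMod p :=
  fun i => dot x (B.L i)

/-- The bilinear form `β_Q`. -/
def betaQ (B : QuadFactor p n ℓ q) (x y : Vec p n) : Fin q → ZMod p :=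
  fun j => dot x ((B.Q j).mulVec y)

/-- The labelling map `β_𝓑`. -/
def betaB (B : QuadFactor p n ℓ q) (x : Vec p n) : Label p ℓ q :=
  (B.betaL x, B.betaQ x x)

/-- The atom of `B` with label `ab`. -/
def atom (B : QuadFactor p n ℓ q) (ab : Label p ℓ q) : Set (Vec p n) :=
  {x | B.betaB x = ab}

/-- The fibre `β_Q^{-1}(d) ⊆ G × G`. -/
def fibQ (B : QuadFactor p n ℓ q) (d : Fin q → ZMod p) : Set (Vec p n × Vec p n) :=
  {xy | B.betaQ xy.1 xy.2 = d}

/-- The rank of a quadratic factor: `n` if `q = 0`, and otherwise the minimal rank of a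
nontrivial linear combination of the matrices. -/
def rank (B : QuadFactor p n ℓ q) : ℕ :=
  if q = 0 then n
  else sInf ((fun c : Fin q → ZMod p => (∑ j, c j • B.Q j).rank) '' {c | c ≠ 0})

end QuadFactor

/-- Refinement of quadratic factors: every atom of `B'` is contained in an atom of `B`. -/
def Refines {p n ℓ' q' ℓ q : ℕ} (B' : QuadFactor p n ℓ' q') (B : QuadFactor p n ℓ q) : Prop :=
  ∀ ab' : Label p ℓ' q', ∃ ab : Label p ℓ q, B'.atom ab' ⊆ B.atom ab

/-- `Σ(d)` for a tuple of labels `d = (d_a, d_b, d_c, d_ab, d_ac, d_bc)`. -/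
def SigmaD {p ℓ q : ℕ} (da db dc : Label p ℓ q) (dab dac dbc : Fin q → ZMod p) :
    Label p ℓ q :=
  (da.1 + db.1 + dc.1, da.2 + db.2 + dc.2 + 2 • dab + 2 • dac + 2 • dbc)

/-- Real-valued indicator function of a set. -/
def ind1 {G : Type*} (S : Set G) : G → ℝ := S.indicator 1

/-- Density of `A` on `P`. -/
def density {G : Type*} (A P : Set G) : ℝ := ((A ∩ P).ncard : ℝ) / (P.ncard : ℝ)

/-- Sum of `g` over a set in a fintype. -/
def setSum {α : Type*} [Fintype α] (s : Set α) (g : α → ℝ) : ℝ :=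
  ∑ x ∈ Finset.univ.filter (fun x => x ∈ s), g x

/-- Average of `g` over a set in a fintype. -/
def expOver {α : Type*} [Fintype α] (s : Set α) (g : α → ℝ) : ℝ :=
  setSum s g / (s.ncard : ℝ)

/-- The normalized indicator `μ_Γ` of `Γ ⊆ G × G`. -/
def mu {G : Type*} [Fintype G] (Γ : Set (G × G)) (xy : G × G) : ℝ :=
  ((Fintype.card G : ℝ) ^ 2 / (Γ.ncard : ℝ)) * ind1 Γ xy

/-- The product of the 8 values of `f` on the cube generated by `x, h₁, h₂, h₃`. -/
def cubeProd {G : Type*} [AddCommGroup G] (f : G → ℝ) (x h₁ h₂ h₃ : G) : ℝ :=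
  f x * f (x + h₁) * f (x + h₂) * f (x + h₃) * f (x + h₁ + h₂) * f (x + h₁ + h₃) *
    f (x + h₂ + h₃) * f (x + h₁ + h₂ + h₃)

/-- The eighth power of the (unnormalized) `U³` norm. -/
def U3pow8 {G : Type*} [AddCommGroup G] [Fintype G] (f : G → ℝ) : ℝ :=
  ∑ x : G, ∑ h₁ : G, ∑ h₂ : G, ∑ h₃ : G, cubeProd f x h₁ h₂ h₃

/-- The (unnormalized) `U³` norm. -/
def U3norm {G : Type*} [AddCommGroup G] [Fintype G] (f : G → ℝ) : ℝ :=
  U3pow8 f ^ ((1 : ℝ) / 8)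

/-- The Prendiville local `U³` norm of `f` relative to the set `B`
(equal to `0` when `‖1_B‖_{U³} = 0`, by the division-by-zero convention). -/
def U3localP {G : Type*} [AddCommGroup G] [Fintype G] (f : G → ℝ) (B : Set G) : ℝ :=
  U3norm (fun x => f x * ind1 B x) / U3norm (ind1 B)

/-- `Ω_B`: the 4-tuples all of whose associated cube points lie in `B`. -/
def Omega {G : Type*} [AddCommGroup G] (B : Set G) : Set (G × G × G × G) :=
  fun t =>
    match t with
    | (x, h₁, h₂, h₃) =>
        x ∈ B ∧ x + h₁ ∈ B ∧ x + h₂ ∈ B ∧ x + h₃ ∈ B ∧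
        x + h₁ + h₂ ∈ B ∧ x + h₁ + h₃ ∈ B ∧ x + h₂ + h₃ ∈ B ∧ x + h₁ + h₂ + h₃ ∈ B

/-- The change of variables `Ψ : G⁶ → G⁴`. -/
def Psi {G : Type*} [AddCommGroup G] : G × G × G × G × G × G → G × G × G × G :=
  fun t =>
    match t with
    | (x₁, x₂, y₁, y₂, z₁, z₂) => (x₁ + y₁ + z₁, x₂ - x₁, y₂ - y₁, z₂ - z₁)

/-- `K_{2,2,2}(d)`. -/
def K222 {p n ℓ q : ℕ} (B : QuadFactor p n ℓ q) (da db dc : Label p ℓ q)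
    (dab dac dbc : Fin q → ZMod p) :
    Set (Vec p n × Vec p n × Vec p n × Vec p n × Vec p n × Vec p n) :=
  fun t =>
    match t with
    | (x₁, x₂, y₁, y₂, z₁, z₂) =>
        B.betaB x₁ = da ∧ B.betaB x₂ = da ∧ B.betaB y₁ = db ∧ B.betaB y₂ = db ∧
        B.betaB z₁ = dc ∧ B.betaB z₂ = dc ∧
        B.betaQ x₁ y₁ = dab ∧ B.betaQ x₁ y₂ = dab ∧ B.betaQ x₂ y₁ = dab ∧ B.betaQ x₂ y₂ = dab ∧
        B.betaQ x₁ z₁ = dac ∧ B.betaQ x₁ z₂ = dac ∧ B.betaQ x₂ z₁ = dac ∧ B.betaQ x₂ z₂ = dac ∧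
        B.betaQ y₁ z₁ = dbc ∧ B.betaQ y₁ z₂ = dbc ∧ B.betaQ y₂ z₁ = dbc ∧ B.betaQ y₂ z₂ = dbc

/-- The product `∏_{i,j,k ∈ {1,2}} f (x_i + y_j + z_k)` for a 6-tuple. -/
def prod8 {G : Type*} [AddCommGroup G] (f : G → ℝ) :
    G × G × G × G × G × G → ℝ :=
  fun t =>
    match t with
    | (x₁, x₂, y₁, y₂, z₁, z₂) =>
        f (x₁ + y₁ + z₁) * f (x₁ + y₁ + z₂) * f (x₁ + y₂ + z₁) * f (x₁ + y₂ + z₂) *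
        f (x₂ + y₁ + z₁) * f (x₂ + y₁ + z₂) * f (x₂ + y₂ + z₁) * f (x₂ + y₂ + z₂)

/-- The eighth power of the Terry–Wolf local `U³` norm. -/
def TW8 {p n ℓ q : ℕ} [NeZero p] (B : QuadFactor p n ℓ q) (f : Vec p n → ℝ)
    (da db dc : Label p ℓ q) (dab dac dbc : Fin q → ZMod p) : ℝ :=
  expOver (B.atom da) fun x₀ => expOver (B.atom da) fun x₁ =>
  expOver (B.atom db) fun y₀ => expOver (B.atom db) fun y₁ =>
  expOver (B.atom dc) fun z₀ => expOver (B.atom dc) fun z₁ =>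
    (mu (B.fibQ dab) (x₀, y₀) * mu (B.fibQ dab) (x₀, y₁) *
     mu (B.fibQ dab) (x₁, y₀) * mu (B.fibQ dab) (x₁, y₁) *
     mu (B.fibQ dac) (x₀, z₀) * mu (B.fibQ dac) (x₀, z₁) *
     mu (B.fibQ dac) (x₁, z₀) * mu (B.fibQ dac) (x₁, z₁) *
     mu (B.fibQ dbc) (y₀, z₀) * mu (B.fibQ dbc) (y₀, z₁) *
     mu (B.fibQ dbc) (y₁, z₀) * mu (B.fibQ dbc) (y₁, z₁)) *
    prod8 f (x₀, x₁, y₀, y₁, z₀, z₁)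

/-- `A` has VC₂-dimension at least `k`. -/
def HasVC2Dim {G : Type*} [AddCommGroup G] (A : Set G) (k : ℕ) : Prop :=
  ∃ (a b : Fin k → G) (c : Set (Fin k × Fin k) → G),
    ∀ (i j : Fin k) (S : Set (Fin k × Fin k)), (a i + b j + c S ∈ A ↔ (i, j) ∈ S)

/-- `A` has VC₂-dimension at most `k`. -/
def VC2dimLE {G : Type*} [AddCommGroup G] (A : Set G) (k : ℕ) : Prop :=
  ∀ m : ℕ, HasVC2Dim A m → m ≤ k

/-- A growth function: an increasing function `ℝ → ℝ≥0`. -/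
def GrowthFunction (ρ : ℝ → ℝ) : Prop :=
  Monotone ρ ∧ ∀ x, 0 ≤ ρ x

/-- `ρ` is bounded by a polynomial of degree `d` on `[1, ∞)`. -/
def PolyBound (ρ : ℝ → ℝ) (d : ℕ) : Prop :=
  ∃ C > (0 : ℝ), ∀ x : ℝ, 1 ≤ x → ρ x ≤ C * x ^ d

/-- `ρ` is a polynomial growth function of degree (exactly) `d`, i.e. `d ≥ 1` is minimal
with `ρ(x) ≤ C x^d` for `x ≥ 1`. -/
def PolyGrowthDegree (ρ : ℝ → ℝ) (d : ℕ) : Prop :=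
  1 ≤ d ∧ PolyBound ρ d ∧ ∀ d' : ℕ, 1 ≤ d' → PolyBound ρ d' → d ≤ d'

/-- The index `ind(A, 𝒫)` of a partition. -/
def indx {p n : ℕ} (A : Set (Vec p n)) (Ps : Finset (Set (Vec p n))) : ℝ :=
  (∑ P ∈ Ps, density A P ^ 2 * (P.ncard : ℝ)) / (p : ℝ) ^ n

/-- `P` fails to be `δ`-uniform for `A` with respect to the localized `U³` norm. -/
def BadPart {G : Type*} [AddCommGroup G] [Fintype G] (δ : ℝ) (A P : Set G) : Prop :=
  δ * U3norm (ind1 P) < U3norm (fun x => (ind1 A x - density A P) * ind1 P x)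

/-- `ker(U)^⊥`, the orthogonal complement of the kernel of `U`. -/
def kerPerp {p n : ℕ} (U : Matrix (Fin n) (Fin n) (ZMod p)) : Set (Vec p n) :=
  {v | ∀ w : Vec p n, U.mulVec w = 0 → dot v w = 0}

/-- `B'` is a `ρ`-matrix deletion of `B`. -/
def IsMatrixDeletion {p n ℓ' q' ℓ q : ℕ} (ρ : ℝ → ℝ)
    (B' : QuadFactor p n ℓ' q') (B : QuadFactor p n ℓ q) : Prop :=
  q' + 1 = q ∧
  ∃ c : Fin q → ZMod p, c ≠ 0 ∧
    (((∑ j, c j • B.Q j).rank : ℝ) < ρ ((ℓ : ℝ) + (q : ℝ))) ∧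
    (∃ i : Fin q, c i ≠ 0 ∧ Set.range B'.Q = Set.range B.Q \ {B.Q i}) ∧
    Set.range B.L ⊆ Set.range B'.L ∧
    Submodule.span (ZMod p) (Set.range B'.L) =
      Submodule.span (ZMod p) (Set.range B.L ∪ kerPerp (∑ j, c j • B.Q j))

/-- The functions `τ_i^ρ : ℤ × ℤ → ℝ`. -/
def tau (ρ : ℝ → ℝ) : ℕ → ℤ × ℤ → ℝ
  | 0, xy => (xy.1 : ℝ)
  | i + 1, xy => tau ρ i xy + ρ (tau ρ i xy + (xy.2 : ℝ) - (i : ℝ))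

/-- `f_σ^ρ` for binary strings `σ : Fin m → ℤ` (with values in `{-1, 1}`). -/
def fseq (ρ : ℝ → ℝ) : (m : ℕ) → (Fin m → ℤ) → ℝ × ℝ
  | 0, _ => (0, 0)
  | m + 1, σ =>
      let ab := fseq ρ m (fun j => σ j.castSucc)
      if σ (Fin.last m) = 1 then (ab.1 + 1, ab.2 + 1)
      else (ab.1 + ρ (ab.1 + ab.2), ab.2 - 1)

end

section CharacterSums

variable {p : ℕ} [NeZero p]

lemma norm_sum_stdAddChar_sq_le [Fact p.Prime] {V : Type*} [AddCommGroup V]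
    [Module (ZMod p) V] [Fintype V] (Φ : V → ZMod p) (β : V →ₗ[ZMod p] V →ₗ[ZMod p] ZMod p)
    (hΦ : ∀ h v, Φ (v + h) = Φ v + Φ h + β h v) :
    ‖∑ v, ZMod.stdAddChar (Φ v)‖ ^ 2 ≤
      (Fintype.card V : ℝ) * (Fintype.card (LinearMap.ker β) : ℝ) := by
  have expand : ((‖∑ v, ZMod.stdAddChar (Φ v)‖ ^ 2 : ℝ) : ℂ) =
      ∑ h, ZMod.stdAddChar (Φ h) * ∑ v, ZMod.stdAddChar (β h v) := by
    rw [Complex.ofReal_pow, ← Complex.mul_conj', map_sum, Finset.sum_mul_sum, Finset.sum_comm]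
    simp_rw [← AddChar.map_neg_eq_conj, Finset.mul_sum, ← AddChar.map_add_eq_mul]
    rw [Finset.sum_comm (f := fun h v => ZMod.stdAddChar (Φ h + β h v))]
    refine Finset.sum_congr rfl fun v _ => ?_
    refine (Fintype.sum_equiv (Equiv.addLeft v) _ _ fun h => ?_).symm
    simp only [Equiv.coe_addLeft, hΦ]
    congr 1
    ring
  have inner (h : V) : ‖∑ v, ZMod.stdAddChar (β h v)‖ =
      if h ∈ LinearMap.ker β then (Fintype.card V : ℝ) else 0 := by
    split_ifs with hh
    · simp [LinearMap.mem_ker.mp hh]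
    · rw [norm_eq_zero]
      have : ZMod.stdAddChar.compAddMonoidHom (β h).toAddMonoidHom ≠ 1 := by
        intro H
        refine hh (LinearMap.mem_ker.mpr (LinearMap.ext fun v => ?_))
        have := DFunLike.congr_fun H v
        apply ZMod.injective_stdAddChar (N := p)
        simpa using this
      simpa using AddChar.sum_eq_zero_of_ne_one this
  calc ‖∑ v, ZMod.stdAddChar (Φ v)‖ ^ 2
      = ‖((‖∑ v, ZMod.stdAddChar (Φ v)‖ ^ 2 : ℝ) : ℂ)‖ := by
        rw [Complex.norm_real, Real.norm_of_nonneg (by positivity)]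
    _ ≤ ∑ h, ‖∑ v, ZMod.stdAddChar (β h v)‖ := by
        rw [expand]
        refine (norm_sum_le _ _).trans (Finset.sum_le_sum fun h _ => ?_)
        rw [norm_mul, AddChar.norm_apply, one_mul]
    _ = _ := by
        simp_rw [inner]
        rw [← Finset.sum_filter, Finset.sum_const, nsmul_eq_mul, mul_comm, Fintype.card_subtype]

lemma norm_sum_stdAddChar_le [Fact p.Prime] {V : Type*} [AddCommGroup V]
    [Module (ZMod p) V] [Fintype V] (Φ : V → ZMod p) (β : V →ₗ[ZMod p] V →ₗ[ZMod p] ZMod p)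
    (hΦ : ∀ h v, Φ (v + h) = Φ v + Φ h + β h v) {r : ℕ}
    (hr : r ≤ Module.finrank (ZMod p) (LinearMap.range β)) :
    ‖∑ v, ZMod.stdAddChar (Φ v)‖ ≤ (Fintype.card V : ℝ) / Real.sqrt ((p : ℝ) ^ r) := by
  have hp : 0 < (p : ℝ) := by exact_mod_cast NeZero.pos p
  have hker : (Fintype.card (LinearMap.ker β) : ℝ) * (p : ℝ) ^ r ≤ Fintype.card V := by
    rw [Module.card_eq_pow_finrank (K := ZMod p) (V := LinearMap.ker β),
      Module.card_eq_pow_finrank (K := ZMod p) (V := V), ZMod.card,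
      ← LinearMap.finrank_range_add_finrank_ker β, add_comm, pow_add]
    push_cast
    gcongr
    exact_mod_cast NeZero.one_le
  rw [le_div_iff₀ (by positivity)]
  refine le_of_sq_le_sq ?_ (by positivity)
  rw [mul_pow, Real.sq_sqrt (by positivity)]
  calc _ ≤ _ := mul_le_mul_of_nonneg_right (norm_sum_stdAddChar_sq_le Φ β hΦ) (by positivity)
    _ ≤ _ := by rw [mul_assoc, sq]; gcongr

lemma sum_stdAddChar_dotProduct {J : Type*} [Fintype J] (w : J → ZMod p) :
    ∑ c : J → ZMod p, ZMod.stdAddChar (c ⬝ᵥ w) = if w = 0 then (p : ℂ) ^ Fintype.card J else 0 := by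
  split_ifs with hw
  · simp [hw]
  · let φ : (J → ZMod p) →+ ZMod p :=
      { toFun := fun c => c ⬝ᵥ w
        map_zero' := zero_dotProduct w
        map_add' := fun a b => add_dotProduct a b w }
    have : ZMod.stdAddChar.compAddMonoidHom φ ≠ 1 := by
      intro H
      refine hw (dotProduct_eq_zero w fun c => ?_)
      apply ZMod.injective_stdAddChar (N := p)
      simpa [φ, dotProduct_comm] using DFunLike.congr_fun H c
    simpa [φ] using AddChar.sum_eq_zero_of_ne_one this

lemma abs_card_fiber_mul_sub_le {V J : Type*} [Fintype V] [Fintype J] (φ : V → J → ZMod p)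
    (a : J → ZMod p) {δ : ℝ}
    (hδ : ∀ c : J → ZMod p, c ≠ 0 → ‖∑ v, ZMod.stdAddChar (c ⬝ᵥ φ v)‖ ≤ δ) :
    |((univ.filter fun v => φ v = a).card : ℝ) * (p : ℝ) ^ Fintype.card J - Fintype.card V| ≤
      ((p : ℝ) ^ Fintype.card J - 1) * δ := by
  have key : (((univ.filter fun v => φ v = a).card : ℝ) * (p : ℝ) ^ Fintype.card J
      - Fintype.card V : ℂ) =
      ∑ c ∈ univ.erase (0 : J → ZMod p),
        ZMod.stdAddChar (-(c ⬝ᵥ a)) * ∑ v, ZMod.stdAddChar (c ⬝ᵥ φ v) := by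
    have total : ∑ c : J → ZMod p,
        ZMod.stdAddChar (-(c ⬝ᵥ a)) * ∑ v, ZMod.stdAddChar (c ⬝ᵥ φ v) =
        ((univ.filter fun v => φ v = a).card : ℂ) * (p : ℂ) ^ Fintype.card J := by
      simp_rw [Finset.mul_sum, ← AddChar.map_add_eq_mul]
      rw [Finset.sum_comm]
      have (v : V) : ∑ c : J → ZMod p, ZMod.stdAddChar (-(c ⬝ᵥ a) + c ⬝ᵥ φ v) =
          if φ v = a then (p : ℂ) ^ Fintype.card J else 0 := by
        rw [← if_congr (sub_eq_zero (a := φ v)) rfl rfl, ← sum_stdAddChar_dotProduct]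
        simp_rw [dotProduct_sub, sub_eq_neg_add]
      simp_rw [this]
      rw [← Finset.sum_filter, Finset.sum_const, nsmul_eq_mul]
    rw [← Finset.add_sum_erase _ _ (mem_univ 0)] at total
    simp only [zero_dotProduct, neg_zero, AddChar.map_zero_eq_one, one_mul, sum_const,
      card_univ, nsmul_eq_mul, mul_one] at total
    rw [eq_comm, eq_sub_iff_add_eq', total]
    push_cast
    rfl
  have hnorm := congrArg norm key
  rw [← Real.norm_eq_abs, ← Complex.norm_real]
  push_cast
  push_cast at hnorm
  rw [hnorm]
  calc _ ≤ ∑ c ∈ univ.erase (0 : J → ZMod p), δ := by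
        refine (norm_sum_le _ _).trans (Finset.sum_le_sum fun c hc => ?_)
        rw [norm_mul, AddChar.norm_apply, one_mul]
        exact hδ c (Finset.ne_of_mem_erase hc)
    _ = _ := by
        rw [Finset.sum_const, Finset.card_erase_of_mem (mem_univ _), nsmul_eq_mul,
          Nat.cast_sub (Finset.card_pos.mpr ⟨0, mem_univ _⟩), card_univ]
        simp

end CharacterSums

namespace QuadFactor

variable {p n ℓ q : ℕ} (B : QuadFactor p n ℓ q)

lemma betaL_add (x y : Vec p n) : B.betaL (x + y) = B.betaL x + B.betaL y := by
  funext i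
  exact add_dotProduct x y (B.L i)

lemma betaL_neg (x : Vec p n) : B.betaL (-x) = -B.betaL x := by
  funext i
  exact neg_dotProduct x (B.L i)

lemma betaL_sub (x y : Vec p n) : B.betaL (x - y) = B.betaL x - B.betaL y := by
  rw [sub_eq_add_neg, betaL_add, betaL_neg, sub_eq_add_neg]

lemma betaQ_add_left (x y z : Vec p n) : B.betaQ (x + y) z = B.betaQ x z + B.betaQ y z := by
  funext i
  exact add_dotProduct x y _

lemma betaQ_comm (x y : Vec p n) : B.betaQ x y = B.betaQ y x := by
  funext i
  change x ⬝ᵥ (B.Q i).mulVec y = y ⬝ᵥ (B.Q i).mulVec x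
  rw [Matrix.dotProduct_mulVec, ← Matrix.mulVec_transpose, B.symm i, dotProduct_comm]

lemma betaQ_add_right (x y z : Vec p n) : B.betaQ x (y + z) = B.betaQ x y + B.betaQ x z := by
  rw [betaQ_comm, betaQ_add_left, betaQ_comm _ y, betaQ_comm _ z]

lemma betaQ_smul_left (c : ZMod p) (x y : Vec p n) : B.betaQ (c • x) y = c • B.betaQ x y := by
  funext i
  exact smul_dotProduct c x _

lemma betaQ_smul_right (c : ZMod p) (x y : Vec p n) : B.betaQ x (c • y) = c • B.betaQ x y := by
  rw [betaQ_comm, betaQ_smul_left, betaQ_comm]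

lemma betaQ_neg_left (x y : Vec p n) : B.betaQ (-x) y = -B.betaQ x y := by
  simpa using B.betaQ_smul_left (-1) x y

lemma betaQ_zero_left (y : Vec p n) : B.betaQ 0 y = 0 := by
  simpa using B.betaQ_smul_left 0 0 y

lemma betaQ_zero_right (x : Vec p n) : B.betaQ x 0 = 0 := by
  rw [betaQ_comm, betaQ_zero_left]

lemma betaQ_sub_left (x y z : Vec p n) : B.betaQ (x - y) z = B.betaQ x z - B.betaQ y z := by
  rw [sub_eq_add_neg, betaQ_add_left, betaQ_neg_left, sub_eq_add_neg]

lemma betaQ_sub_right (x y z : Vec p n) : B.betaQ x (y - z) = B.betaQ x y - B.betaQ x z := by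
  rw [betaQ_comm, betaQ_sub_left, betaQ_comm _ y, betaQ_comm _ z]

lemma rank_le_rank_sum_smul {c : Fin q → ZMod p} (hc : c ≠ 0) :
    B.rank ≤ (∑ j, c j • B.Q j).rank := by
  have hq : q ≠ 0 := by
    rintro rfl
    exact hc (Subsingleton.elim _ _)
  rw [rank, if_neg hq]
  exact Nat.sInf_le ⟨c, hc, rfl⟩

lemma sum_mul_betaQ (c : Fin q → ZMod p) (x y : Vec p n) :
    ∑ k, c k * B.betaQ x y k = x ⬝ᵥ (∑ k, c k • B.Q k).mulVec y := by
  simp_rw [Matrix.sum_mulVec, Matrix.smul_mulVec, dotProduct_sum, dotProduct_smul, smul_eq_mul]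
  rfl

section Config

variable {ι T S : Type*} [Fintype T] [Fintype S]

/-- The values at a tuple `v` of the linear forms on the coordinates `τ t`, and of the bilinear
forms on the pairs of coordinates `s t`, the latter shifted by `e t` times a diagonal value. -/
def configMap (τ : T → ι) (s : S → ι × ι) (e : S → ZMod p) (v : ι → Vec p n) :
    (T × Fin ℓ) ⊕ (S × Fin q) → ZMod p :=
  Sum.elim (fun t => B.betaL (v (τ t.1)) t.2) fun t =>
    B.betaQ (v (s t.1).1) (v (s t.1).2) t.2 + e t.1 * B.betaQ (v (s t.1).2) (v (s t.1).2) t.2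

/-- The polarization of a linear combination of the coordinates of `configMap`. -/
def configPolar (s : S → ι × ι) (e : S → ZMod p) (c : S × Fin q → ZMod p) :
    (ι → Vec p n) →ₗ[ZMod p] (ι → Vec p n) →ₗ[ZMod p] ZMod p :=
  LinearMap.mk₂ (ZMod p)
    (fun h v => ∑ t, c t * (B.betaQ (v (s t.1).1) (h (s t.1).2) t.2 +
      B.betaQ (h (s t.1).1) (v (s t.1).2) t.2 +
        2 * e t.1 * B.betaQ (h (s t.1).2) (v (s t.1).2) t.2))
    (fun h h' v => by
      rw [← Finset.sum_add_distrib]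
      refine Finset.sum_congr rfl fun t _ => ?_
      simp only [Pi.add_apply, betaQ_add_left, betaQ_add_right]
      ring)
    (fun a h v => by
      rw [Finset.smul_sum]
      refine Finset.sum_congr rfl fun t _ => ?_
      simp only [Pi.smul_apply, betaQ_smul_left, betaQ_smul_right, smul_eq_mul]
      ring)
    (fun h v v' => by
      rw [← Finset.sum_add_distrib]
      refine Finset.sum_congr rfl fun t _ => ?_
      simp only [Pi.add_apply, betaQ_add_left, betaQ_add_right]
      ring)
    (fun a h v => by
      rw [Finset.smul_sum]
      refine Finset.sum_congr rfl fun t _ => ?_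
      simp only [Pi.smul_apply, betaQ_smul_left, betaQ_smul_right, smul_eq_mul]
      ring)

lemma dotProduct_configMap (τ : T → ι) (s : S → ι × ι) (e : S → ZMod p)
    (c : (T × Fin ℓ) ⊕ (S × Fin q) → ZMod p) (v : ι → Vec p n) :
    c ⬝ᵥ B.configMap τ s e v = ∑ t, c (.inl t) * B.betaL (v (τ t.1)) t.2 +
      ∑ t, c (.inr t) * (B.betaQ (v (s t.1).1) (v (s t.1).2) t.2 +
        e t.1 * B.betaQ (v (s t.1).2) (v (s t.1).2) t.2) := by
  simp [dotProduct, configMap, Fintype.sum_sum_type]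

lemma dotProduct_configMap_add (τ : T → ι) (s : S → ι × ι) (e : S → ZMod p)
    (c : (T × Fin ℓ) ⊕ (S × Fin q) → ZMod p) (h v : ι → Vec p n) :
    c ⬝ᵥ B.configMap τ s e (v + h) = c ⬝ᵥ B.configMap τ s e v + c ⬝ᵥ B.configMap τ s e h +
      B.configPolar s e (fun t => c (.inr t)) h v := by
  simp only [dotProduct_configMap, configPolar, LinearMap.mk₂_apply]
  have reassoc (a b a' b' d : ZMod p) : a + b + (a' + b') + d = (a + a') + (b + b' + d) := by ring
  rw [reassoc, ← Finset.sum_add_distrib, ← Finset.sum_add_distrib, ← Finset.sum_add_distrib]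
  congr 1
  · refine Finset.sum_congr rfl fun t _ => ?_
    simp only [Pi.add_apply, betaL_add]
    ring
  · refine Finset.sum_congr rfl fun t _ => ?_
    simp only [Pi.add_apply, betaQ_add_left, betaQ_add_right,
      B.betaQ_comm (v (s t.1).2) (h (s t.1).2)]
    ring

variable [Fintype ι] [DecidableEq ι]

lemma rank_le_finrank_range_of_single [Fact p.Prime]
    {β : (ι → Vec p n) →ₗ[ZMod p] (ι → Vec p n) →ₗ[ZMod p] ZMod p} {i j : ι}
    {c : Fin q → ZMod p} (hc : c ≠ 0)
    (hβ : ∀ w u, β (Pi.single j w) (Pi.single i u) = ∑ k, c k * B.betaQ u w k) :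
    B.rank ≤ Module.finrank (ZMod p) (LinearMap.range β) := by
  refine (B.rank_le_rank_sum_smul hc).trans ?_
  set M := ∑ k, c k • B.Q k
  let D : Vec p n →ₗ[ZMod p] Module.Dual (ZMod p) (Vec p n) :=
    (dotProductBilin (ZMod p) (ZMod p)).flip
  have hD : LinearMap.ker D = ⊥ := by
    refine LinearMap.ker_eq_bot'.mpr fun w hw => dotProduct_eq_zero w fun u => ?_
    rw [dotProduct_comm]
    exact DFunLike.congr_fun hw u
  have hcomp : D ∘ₗ M.mulVecLin =
      (LinearMap.lcomp (ZMod p) (ZMod p) (LinearMap.single (ZMod p) (fun _ => Vec p n) i)) ∘ₗ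
        β ∘ₗ LinearMap.single (ZMod p) (fun _ => Vec p n) j := by
    refine LinearMap.ext fun w => LinearMap.ext fun u => ?_
    exact (B.sum_mul_betaQ c u w).symm.trans (hβ w u).symm
  calc M.rank = Module.finrank (ZMod p) (LinearMap.range (D ∘ₗ M.mulVecLin)) := by
        rw [LinearMap.range_comp]
        exact LinearEquiv.finrank_eq
          (Submodule.equivMapOfInjective D (LinearMap.ker_eq_bot.mp hD) _)
    _ ≤ _ := by
        rw [hcomp, LinearMap.range_comp]
        refine (Submodule.finrank_map_le _ _).trans ?_
        exact Submodule.finrank_mono (LinearMap.range_comp_le_range _ _)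

lemma rank_le_finrank_range_configPolar [Fact p.Prime] (hp : p ≠ 2) {s : S → ι × ι}
    (hs : ∀ t t', s t = s t' ∨ s t = (s t').swap → t = t') {e : S → ZMod p}
    (he : ∀ t, (s t).1 = (s t).2 → e t = 0) {c : S × Fin q → ZMod p} (hc : c ≠ 0) :
    B.rank ≤ Module.finrank (ZMod p) (LinearMap.range (B.configPolar s e c)) := by
  have two_ne : (2 : ZMod p) ≠ 0 := by
    intro h
    have := (ZMod.natCast_eq_zero_iff 2 p).mp (by exact_mod_cast h)
    exact hp ((Nat.prime_dvd_prime_iff_eq Fact.out Nat.prime_two).mp this)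
  by_cases hoff : ∃ t k, (s t).1 ≠ (s t).2 ∧ c (t, k) ≠ 0
  · obtain ⟨t₀, k₀, hne, hk₀⟩ := hoff
    refine B.rank_le_finrank_range_of_single (i := (s t₀).1) (j := (s t₀).2)
      (c := fun k => c (t₀, k)) (fun h => hk₀ (congrFun h k₀)) fun w u => ?_
    simp only [configPolar, LinearMap.mk₂_apply]
    rw [Fintype.sum_prod_type, Finset.sum_eq_single t₀]
    · refine Finset.sum_congr rfl fun k _ => ?_
      simp [hne, hne.symm, betaQ_zero_right]
    · intro t _ ht
      refine Finset.sum_eq_zero fun k _ => ?_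
      have h1 : ¬((s t).1 = (s t₀).1 ∧ (s t).2 = (s t₀).2) := fun h =>
        ht (hs _ _ (Or.inl (Prod.ext h.1 h.2)))
      have h2 : ¬((s t).1 = (s t₀).2 ∧ (s t).2 = (s t₀).1) := fun h =>
        ht (hs _ _ (Or.inr (Prod.ext h.1 h.2)))
      have z1 : B.betaQ ((Pi.single (s t₀).1 u : ι → Vec p n) (s t).1)
          ((Pi.single (s t₀).2 w : ι → Vec p n) (s t).2) = 0 := by
        by_cases h : (s t).1 = (s t₀).1
        · rw [Pi.single_eq_of_ne (fun h' => h1 ⟨h, h'⟩), betaQ_zero_right]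
        · rw [Pi.single_eq_of_ne h, betaQ_zero_left]
      have z2 : B.betaQ ((Pi.single (s t₀).2 w : ι → Vec p n) (s t).1)
          ((Pi.single (s t₀).1 u : ι → Vec p n) (s t).2) = 0 := by
        by_cases h : (s t).1 = (s t₀).2
        · rw [Pi.single_eq_of_ne (fun h' => h2 ⟨h, h'⟩), betaQ_zero_right]
        · rw [Pi.single_eq_of_ne h, betaQ_zero_left]
      have z3 : B.betaQ ((Pi.single (s t₀).2 w : ι → Vec p n) (s t).2)
          ((Pi.single (s t₀).1 u : ι → Vec p n) (s t).2) = 0 := by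
        by_cases h : (s t).2 = (s t₀).2
        · rw [Pi.single_eq_of_ne (fun h' => hne (h'.symm.trans h)), betaQ_zero_right]
        · rw [Pi.single_eq_of_ne h, betaQ_zero_left]
      simp [z1, z2, z3]
    · simp
  · push Not at hoff
    obtain ⟨⟨t₀, k₀⟩, hk₀⟩ := Function.ne_iff.mp hc
    have heq : (s t₀).1 = (s t₀).2 := by
      by_contra h
      exact hk₀ (hoff t₀ k₀ h)
    refine B.rank_le_finrank_range_of_single (i := (s t₀).2) (j := (s t₀).2)
      (c := fun k => 2 * c (t₀, k)) (fun h => ?_) fun w u => ?_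
    · exact (mul_ne_zero two_ne hk₀) (congrFun h k₀)
    simp only [configPolar, LinearMap.mk₂_apply]
    rw [Fintype.sum_prod_type, Finset.sum_eq_single t₀]
    · refine Finset.sum_congr rfl fun k _ => ?_
      rw [heq, he t₀ heq, Pi.single_eq_same, Pi.single_eq_same, B.betaQ_comm w u]
      ring
    · intro t _ ht
      refine Finset.sum_eq_zero fun k _ => ?_
      by_cases hdiag : (s t).1 = (s t).2
      · have h : (s t).2 ≠ (s t₀).2 := fun h =>
          ht (hs _ _ (Or.inl (Prod.ext (hdiag.trans (h.trans heq.symm)) h)))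
        rw [hdiag, Pi.single_eq_of_ne h, Pi.single_eq_of_ne h]
        simp [betaQ_zero_left]
      · rw [hoff t k hdiag, zero_mul]
    · simp

lemma norm_sum_configMap_le [NeZero p] [Fact p.Prime] (hp : p ≠ 2) {τ : T → ι}
    (hτ : Function.Injective τ) {s : S → ι × ι}
    (hs : ∀ t t', s t = s t' ∨ s t = (s t').swap → t = t') {e : S → ZMod p}
    (he : ∀ t, (s t).1 = (s t).2 → e t = 0) {c : (T × Fin ℓ) ⊕ (S × Fin q) → ZMod p}
    (hc : c ≠ 0) :
    ‖∑ v, ZMod.stdAddChar (c ⬝ᵥ B.configMap τ s e v)‖ ≤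
      (Fintype.card (ι → Vec p n) : ℝ) / Real.sqrt ((p : ℝ) ^ B.rank) := by
  by_cases hQ : (fun t => c (.inr t)) = 0
  · have hL : (fun t => c (.inl t)) ≠ 0 := by
      intro hL
      refine hc (funext fun t => ?_)
      cases t with
      | inl t => exact congrFun hL t
      | inr t => exact congrFun hQ t
    obtain ⟨⟨t₀, k₀⟩, hk₀⟩ := Function.ne_iff.mp hL
    let φ : (ι → Vec p n) →+ ZMod p := AddMonoidHom.mk' (fun v => c ⬝ᵥ B.configMap τ s e v)
      fun v h => by
        rw [dotProduct_configMap_add, hQ]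
        simp [configPolar]
    have hφ : ZMod.stdAddChar.compAddMonoidHom φ ≠ 1 := by
      intro H
      have hw : ∑ k, c (.inl (t₀, k)) • B.L k = 0 := by
        refine dotProduct_eq_zero _ fun u => ?_
        apply ZMod.injective_stdAddChar (N := p)
        rw [AddChar.map_zero_eq_one]
        refine Eq.trans ?_ (DFunLike.congr_fun H (Pi.single (τ t₀) u))
        rw [AddChar.compAddMonoidHom_apply]
        congr 1
        change _ = c ⬝ᵥ B.configMap τ s e (Pi.single (τ t₀) u)
        rw [dotProduct_configMap, Finset.sum_eq_zero (s := univ) (f := fun t : S × Fin q => _)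
          fun t _ => by rw [show c (.inr t) = 0 from congrFun hQ t, zero_mul], add_zero,
          Fintype.sum_prod_type, Finset.sum_eq_single t₀]
        · rw [sum_dotProduct]
          refine Finset.sum_congr rfl fun k _ => ?_
          rw [Pi.single_eq_same, smul_dotProduct, dotProduct_comm]
          rfl
        · intro t _ ht
          refine Finset.sum_eq_zero fun k _ => ?_
          rw [Pi.single_eq_of_ne fun h => ht (hτ h)]
          simp [betaL, dot]
        · simp
      exact hk₀ (Fintype.linearIndependent_iff.mp B.linIndep (fun k => c (.inl (t₀, k))) hw k₀)
    have : ∑ v, ZMod.stdAddChar (c ⬝ᵥ B.configMap τ s e v) = 0 :=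
      AddChar.sum_eq_zero_of_ne_one hφ
    rw [this, norm_zero]
    positivity
  · exact norm_sum_stdAddChar_le _ _ (fun h v => B.dotProduct_configMap_add τ s e c h v)
      (B.rank_le_finrank_range_configPolar hp hs he hQ)

/-- The number of tuples with prescribed values of independent linear and bilinear forms. -/
lemma abs_card_config_mul_sub_le [NeZero p] [Fact p.Prime] (hp : p ≠ 2) {τ : T → ι}
    (hτ : Function.Injective τ) {s : S → ι × ι}
    (hs : ∀ t t', s t = s t' ∨ s t = (s t').swap → t = t') {e : S → ZMod p}
    (he : ∀ t, (s t).1 = (s t).2 → e t = 0) (a : T → Fin ℓ → ZMod p) (b : S → Fin q → ZMod p) :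
    |((univ.filter fun v : ι → Vec p n => (∀ t, B.betaL (v (τ t)) = a t) ∧
        ∀ t, B.betaQ (v (s t).1) (v (s t).2) + e t • B.betaQ (v (s t).2) (v (s t).2) = b t).card
          : ℝ) * (p : ℝ) ^ (Fintype.card T * ℓ + Fintype.card S * q) -
        (p : ℝ) ^ (n * Fintype.card ι)| ≤
      ((p : ℝ) ^ (Fintype.card T * ℓ + Fintype.card S * q) - 1) *
        ((p : ℝ) ^ (n * Fintype.card ι) / Real.sqrt ((p : ℝ) ^ B.rank)) := by
  have h := abs_card_fiber_mul_sub_le (B.configMap τ s e)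
    (Sum.elim (fun t => a t.1 t.2) fun t => b t.1 t.2)
    fun c hc => B.norm_sum_configMap_le hp hτ hs he hc
  have hfilter : (univ.filter fun v : ι → Vec p n => B.configMap τ s e v =
      Sum.elim (fun t => a t.1 t.2) fun t => b t.1 t.2) =
      univ.filter fun v : ι → Vec p n => (∀ t, B.betaL (v (τ t)) = a t) ∧
        ∀ t, B.betaQ (v (s t).1) (v (s t).2) + e t • B.betaQ (v (s t).2) (v (s t).2) = b t := by
    ext v
    simp [funext_iff, configMap]
  rw [hfilter] at h
  simpa [ZMod.card, ← pow_mul] using h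

end Config

end QuadFactor

namespace QuadFactor

variable {p n ℓ q : ℕ} (B : QuadFactor p n ℓ q)

/-- The conditions on `(x, h₁, h₂, h₃)` for the cube they generate to lie in the atom of `b`. -/
def IsCube (b : Label p ℓ q) (w : Vec p n × Vec p n × Vec p n × Vec p n) : Prop :=
  (B.betaL w.1 = b.1 ∧ B.betaL w.2.1 = 0 ∧ B.betaL w.2.2.1 = 0 ∧ B.betaL w.2.2.2 = 0) ∧
  B.betaQ w.1 w.1 = b.2 ∧
  B.betaQ w.1 w.2.1 + (2⁻¹ : ZMod p) • B.betaQ w.2.1 w.2.1 = 0 ∧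
  B.betaQ w.1 w.2.2.1 + (2⁻¹ : ZMod p) • B.betaQ w.2.2.1 w.2.2.1 = 0 ∧
  B.betaQ w.1 w.2.2.2 + (2⁻¹ : ZMod p) • B.betaQ w.2.2.2 w.2.2.2 = 0 ∧
  B.betaQ w.2.1 w.2.2.1 = 0 ∧ B.betaQ w.2.1 w.2.2.2 = 0 ∧ B.betaQ w.2.2.1 w.2.2.2 = 0

/-- The conditions on `(u, v)` for the cube `w = (x, h₁, h₂, h₃)` to split as the sum of the
pairs `(u, u + h₁)`, `(v, v + h₂)`, `(x - u - v, x - u - v + h₃)` with labels `d`. -/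
def IsSplit (da db : Label p ℓ q) (dab dac dbc : Fin q → ZMod p)
    (w : Vec p n × Vec p n × Vec p n × Vec p n) (u : Vec p n × Vec p n) : Prop :=
  (B.betaL u.1 = da.1 ∧ B.betaL u.2 = db.1) ∧
  B.betaQ u.1 u.1 = da.2 ∧ B.betaQ u.2 u.2 = db.2 ∧ B.betaQ u.1 u.2 = dab ∧
  B.betaQ u.1 w.1 = dac + da.2 + dab ∧ B.betaQ u.2 w.1 = dbc + db.2 + dab ∧
  B.betaQ u.1 w.2.1 + (2⁻¹ : ZMod p) • B.betaQ w.2.1 w.2.1 = 0 ∧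
  B.betaQ u.1 w.2.2.1 = 0 ∧ B.betaQ u.1 w.2.2.2 = 0 ∧
  B.betaQ u.2 w.2.1 = 0 ∧
  B.betaQ u.2 w.2.2.1 + (2⁻¹ : ZMod p) • B.betaQ w.2.2.1 w.2.2.1 = 0 ∧
  B.betaQ u.2 w.2.2.2 = 0

lemma inv_two_smul_eq_mul (y : Fin q → ZMod p) :
    (2⁻¹ : ZMod p) • y = (fun _ => 2⁻¹) * y := rfl

lemma two_mul_const_inv_two [Fact p.Prime] (hp : p ≠ 2) :
    (2 : Fin q → ZMod p) * (fun _ => 2⁻¹) = 1 := by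
  have two_ne : (2 : ZMod p) ≠ 0 := by
    intro h
    have := (ZMod.natCast_eq_zero_iff 2 p).mp (by exact_mod_cast h)
    exact hp ((Nat.prime_dvd_prime_iff_eq Fact.out Nat.prime_two).mp this)
  funext i
  exact mul_inv_cancel₀ two_ne

lemma mem_atom_iff (b : Label p ℓ q) (x : Vec p n) :
    x ∈ B.atom b ↔ B.betaL x = b.1 ∧ B.betaQ x x = b.2 :=
  Prod.ext_iff

lemma mem_Omega_atom_iff [Fact p.Prime] (hp : p ≠ 2) (b : Label p ℓ q)
    (w : Vec p n × Vec p n × Vec p n × Vec p n) :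
    w ∈ Omega (B.atom b) ↔ B.IsCube b w := by
  obtain ⟨x, h₁, h₂, h₃⟩ := w
  have ht := two_mul_const_inv_two (q := q) hp
  change (_ ∧ _ ∧ _ ∧ _ ∧ _ ∧ _ ∧ _ ∧ _) ↔ _
  simp only [IsCube, mem_atom_iff, inv_two_smul_eq_mul, betaL_add, betaQ_add_left, betaQ_add_right, B.betaQ_comm h₁ x,
    B.betaQ_comm h₂ x, B.betaQ_comm h₃ x, B.betaQ_comm h₂ h₁, B.betaQ_comm h₃ h₁,
    B.betaQ_comm h₃ h₂]
  set t : Fin q → ZMod p := fun _ => 2⁻¹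
  constructor
  · rintro ⟨⟨l0, e0⟩, ⟨l1, e1⟩, ⟨l2, e2⟩, ⟨l3, e3⟩, ⟨-, e12⟩, ⟨-, e13⟩, ⟨-, e23⟩, -⟩
    refine ⟨⟨l0, ?_, ?_, ?_⟩, e0, ?_, ?_, ?_, ?_, ?_, ?_⟩
    · linear_combination l1 - l0
    · linear_combination l2 - l0
    · linear_combination l3 - l0
    · linear_combination t * (e1 - e0) - B.betaQ x h₁ * ht
    · linear_combination t * (e2 - e0) - B.betaQ x h₂ * ht
    · linear_combination t * (e3 - e0) - B.betaQ x h₃ * ht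
    · linear_combination t * (e12 - e1 - e2 + e0) - B.betaQ h₁ h₂ * ht
    · linear_combination t * (e13 - e1 - e3 + e0) - B.betaQ h₁ h₃ * ht
    · linear_combination t * (e23 - e2 - e3 + e0) - B.betaQ h₂ h₃ * ht
  · rintro ⟨⟨l0, l1, l2, l3⟩, e0, e1, e2, e3, e12, e13, e23⟩
    refine ⟨⟨l0, e0⟩, ⟨?_, ?_⟩, ⟨?_, ?_⟩, ⟨?_, ?_⟩, ⟨?_, ?_⟩, ⟨?_, ?_⟩, ⟨?_, ?_⟩, ⟨?_, ?_⟩⟩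
    · linear_combination l0 + l1
    · linear_combination e0 + 2 * e1 - B.betaQ h₁ h₁ * ht
    · linear_combination l0 + l2
    · linear_combination e0 + 2 * e2 - B.betaQ h₂ h₂ * ht
    · linear_combination l0 + l3
    · linear_combination e0 + 2 * e3 - B.betaQ h₃ h₃ * ht
    · linear_combination l0 + l1 + l2
    · linear_combination e0 + 2 * e1 - B.betaQ h₁ h₁ * ht + 2 * e2 - B.betaQ h₂ h₂ * ht + 2 * e12
    · linear_combination l0 + l1 + l3
    · linear_combination e0 + 2 * e1 - B.betaQ h₁ h₁ * ht + 2 * e3 - B.betaQ h₃ h₃ * ht + 2 * e13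
    · linear_combination l0 + l2 + l3
    · linear_combination e0 + 2 * e2 - B.betaQ h₂ h₂ * ht + 2 * e3 - B.betaQ h₃ h₃ * ht + 2 * e23
    · linear_combination l0 + l1 + l2 + l3
    · linear_combination e0 + 2 * e1 - B.betaQ h₁ h₁ * ht + 2 * e2 - B.betaQ h₂ h₂ * ht +
        2 * e3 - B.betaQ h₃ h₃ * ht + 2 * e12 + 2 * e13 + 2 * e23

lemma mem_K222_iff [Fact p.Prime] (hp : p ≠ 2) (da db dc : Label p ℓ q)
    (dab dac dbc : Fin q → ZMod p) (x h₁ h₂ h₃ u v : Vec p n) :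
    (u, u + h₁, v, v + h₂, x - u - v, x - u - v + h₃) ∈ K222 B da db dc dab dac dbc ↔
      B.IsCube (SigmaD da db dc dab dac dbc) (x, h₁, h₂, h₃) ∧
        B.IsSplit da db dab dac dbc (x, h₁, h₂, h₃) (u, v) := by
  have ht := two_mul_const_inv_two (q := q) hp
  change (_ ∧ _ ∧ _ ∧ _ ∧ _ ∧ _ ∧ _ ∧ _ ∧ _ ∧ _ ∧ _ ∧ _ ∧ _ ∧ _ ∧ _ ∧ _ ∧ _ ∧ _) ↔ _
  simp only [IsCube, IsSplit, SigmaD, betaB, Prod.ext_iff,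
    inv_two_smul_eq_mul, betaL_add, betaL_sub, betaQ_add_left, betaQ_add_right, betaQ_sub_left,
    betaQ_sub_right, B.betaQ_comm h₁ x, B.betaQ_comm h₂ x, B.betaQ_comm h₃ x, B.betaQ_comm x u, B.betaQ_comm x v, B.betaQ_comm v u, B.betaQ_comm h₁ u,
    B.betaQ_comm h₂ u, B.betaQ_comm h₃ u, B.betaQ_comm h₁ v, B.betaQ_comm h₂ v,
    B.betaQ_comm h₃ v, two_nsmul]
  set t : Fin q → ZMod p := fun _ => 2⁻¹
  constructor
  · rintro ⟨⟨lu, quu⟩, ⟨lu', quu'⟩, ⟨lv, qvv⟩, ⟨lv', qvv'⟩, ⟨lz, qzz⟩, ⟨lz', qzz'⟩,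
      a1, a2, a3, a4, c1, c2, c3, c4, d1, d2, d3, d4⟩
    have uh1 : B.betaQ u h₁ + t * B.betaQ h₁ h₁ = 0 := by
      linear_combination t * (quu' - quu) - B.betaQ u h₁ * ht
    have vh2 : B.betaQ v h₂ + t * B.betaQ h₂ h₂ = 0 := by
      linear_combination t * (qvv' - qvv) - B.betaQ v h₂ * ht
    have uh2 : B.betaQ u h₂ = 0 := by linear_combination a2 - a1
    have vh1 : B.betaQ v h₁ = 0 := by linear_combination a3 - a1
    have uh3 : B.betaQ u h₃ = 0 := by linear_combination c2 - c1
    have vh3 : B.betaQ v h₃ = 0 := by linear_combination d2 - d1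
    refine ⟨⟨⟨?_, ?_, ?_, ?_⟩, ?_, ?_, ?_, ?_, ?_, ?_, ?_⟩, ⟨lu, lv⟩, quu, qvv, a1, ?_, ?_,
      uh1, uh2, uh3, vh1, vh2, vh3⟩
    · linear_combination lu + lv + lz
    · linear_combination lu' - lu
    · linear_combination lv' - lv
    · linear_combination lz' - lz
    · linear_combination qzz + quu + qvv + 2 * a1 + 2 * c1 + 2 * d1
    · linear_combination uh1 + vh1 + c3 - c1
    · linear_combination uh2 + vh2 + d3 - d1
    · linear_combination uh3 + vh3 + t * (qzz' - qzz) -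
        (B.betaQ x h₃ - B.betaQ u h₃ - B.betaQ v h₃) * ht
    · linear_combination a4 - a3 - a2 + a1
    · linear_combination c4 - c3 - c2 + c1
    · linear_combination d4 - d3 - d2 + d1
    · linear_combination c1 + quu + a1
    · linear_combination d1 + qvv + a1
  · rintro ⟨⟨⟨lx, l1, l2, l3⟩, qxx, x1, x2, x3, h12, h13, h23⟩, ⟨lu, lv⟩, quu, qvv, quv, qux, qvx,
      uh1, uh2, uh3, vh1, vh2, vh3⟩
    have c1 : B.betaQ u x - B.betaQ u u - B.betaQ u v = dac := by
      linear_combination qux - quu - quv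
    have d1 : B.betaQ v x - B.betaQ u v - B.betaQ v v = dbc := by
      linear_combination qvx - quv - qvv
    refine ⟨⟨lu, quu⟩, ⟨?_, ?_⟩, ⟨lv, qvv⟩, ⟨?_, ?_⟩, ⟨?_, ?_⟩, ⟨?_, ?_⟩,
      quv, ?_, ?_, ?_, c1, ?_, ?_, ?_, d1, ?_, ?_, ?_⟩
    · linear_combination lu + l1
    · linear_combination quu + 2 * uh1 - B.betaQ h₁ h₁ * ht
    · linear_combination lv + l2
    · linear_combination qvv + 2 * vh2 - B.betaQ h₂ h₂ * ht
    · linear_combination lx - lu - lv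
    · linear_combination qxx - quu - qvv - 2 * quv - 2 * c1 - 2 * d1
    · linear_combination lx - lu - lv + l3
    · linear_combination qxx - quu - qvv - 2 * quv - 2 * c1 - 2 * d1 +
        2 * (x3 - uh3 - vh3) - B.betaQ h₃ h₃ * ht
    · linear_combination quv + uh2
    · linear_combination quv + vh1
    · linear_combination quv + uh2 + vh1 + h12
    · linear_combination c1 + uh3
    · linear_combination c1 + x1 - uh1 - vh1
    · linear_combination c1 + uh3 + x1 - uh1 - vh1 + h13
    · linear_combination d1 + vh3
    · linear_combination d1 + x2 - uh2 - vh2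
    · linear_combination d1 + vh3 + x2 - uh2 - vh2 + h23

end QuadFactor

namespace QuadFactor

variable {p n ℓ q : ℕ} (B : QuadFactor p n ℓ q)

section Config

variable {T S ι : Type*} [Fintype T] [Fintype S] [Fintype ι] [DecidableEq ι]

/-- The relative error, in terms of the rank, of counts involving at most `D` conditions. -/
noncomputable def countError (D : ℕ) : ℝ := ((p : ℝ) ^ D - 1) / Real.sqrt ((p : ℝ) ^ B.rank)

lemma abs_card_config_sub_le [NeZero p] [Fact p.Prime] (hp : p ≠ 2) {τ : T → ι}
    (hτ : Function.Injective τ) {s : S → ι × ι}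
    (hs : ∀ t t', s t = s t' ∨ s t = (s t').swap → t = t') {e : S → ZMod p}
    (he : ∀ t, (s t).1 = (s t).2 → e t = 0) (a : T → Fin ℓ → ZMod p) (b : S → Fin q → ZMod p)
    {D : ℕ} (hD : Fintype.card T * ℓ + Fintype.card S * q ≤ D) :
    |((univ.filter fun v : ι → Vec p n => (∀ t, B.betaL (v (τ t)) = a t) ∧
        ∀ t, B.betaQ (v (s t).1) (v (s t).2) + e t • B.betaQ (v (s t).2) (v (s t).2) = b t).card
          : ℝ) -
        (p : ℝ) ^ (n * Fintype.card ι) / (p : ℝ) ^ (Fintype.card T * ℓ + Fintype.card S * q)| ≤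
      B.countError D * ((p : ℝ) ^ (n * Fintype.card ι) /
        (p : ℝ) ^ (Fintype.card T * ℓ + Fintype.card S * q)) := by
  have hp1 : (1 : ℝ) ≤ p := by exact_mod_cast NeZero.one_le
  have hp0 : (0 : ℝ) < p := by linarith
  have hpow : (p : ℝ) ^ (Fintype.card T * ℓ + Fintype.card S * q) ≤ (p : ℝ) ^ D :=
    pow_le_pow_right₀ hp1 hD
  have h := B.abs_card_config_mul_sub_le hp hτ hs he a b
  set P := (p : ℝ) ^ (Fintype.card T * ℓ + Fintype.card S * q)
  have hP : 0 < P := by positivity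
  rw [← div_le_div_iff_of_pos_right hP, ← abs_of_pos hP, ← abs_div, abs_of_pos hP, sub_div,
    mul_div_cancel_right₀ _ hP.ne'] at h
  refine h.trans ?_
  rw [countError, mul_comm_div, mul_div_assoc, div_right_comm]
  gcongr

end Config

section Forms

variable {ι : Type*}

/-- The pairs of variables on which `IsCube` imposes a bilinear condition. -/
def cubePairs (x h₁ h₂ h₃ : ι) : Fin 7 → ι × ι :=
  ![(x, x), (x, h₁), (x, h₂), (x, h₃), (h₁, h₂), (h₁, h₃), (h₂, h₃)]

/-- The pairs of variables on which `IsSplit` imposes a bilinear condition. -/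
def splitPairs (x h₁ h₂ h₃ u v : ι) : Fin 11 → ι × ι :=
  ![(u, u), (v, v), (u, v), (u, x), (v, x), (u, h₁), (u, h₂), (u, h₃), (v, h₁), (v, h₂), (v, h₃)]

/-- The coefficients of the quadratic terms accompanying `cubePairs`. -/
def cubeCoeff (p : ℕ) : Fin 7 → ZMod p := ![0, 2⁻¹, 2⁻¹, 2⁻¹, 0, 0, 0]

/-- The coefficients of the quadratic terms accompanying `splitPairs`. -/
def splitCoeff (p : ℕ) : Fin 11 → ZMod p := ![0, 0, 0, 0, 0, 2⁻¹, 0, 0, 0, 2⁻¹, 0]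

/-- The values prescribed by `IsSplit` on `splitPairs`. -/
def splitValue (da db : Label p ℓ q) (dab dac dbc : Fin q → ZMod p) :
    Fin 11 → Fin q → ZMod p :=
  ![da.2, db.2, dab, dac + da.2 + dab, dbc + db.2 + dab, 0, 0, 0, 0, 0, 0]

lemma isCube_iff (b : Label p ℓ q) (w : ι → Vec p n) (x h₁ h₂ h₃ : ι) :
    B.IsCube b (w x, w h₁, w h₂, w h₃) ↔
      (∀ t, B.betaL (w (![x, h₁, h₂, h₃] t)) = (![b.1, 0, 0, 0] : Fin 4 → _) t) ∧
      ∀ t, B.betaQ (w (cubePairs x h₁ h₂ h₃ t).1) (w (cubePairs x h₁ h₂ h₃ t).2) +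
        cubeCoeff p t • B.betaQ (w (cubePairs x h₁ h₂ h₃ t).2) (w (cubePairs x h₁ h₂ h₃ t).2) =
          (![b.2, 0, 0, 0, 0, 0, 0] : Fin 7 → _) t := by
  simp [IsCube, cubePairs, cubeCoeff, Fin.forall_fin_succ]

lemma isSplit_iff (da db : Label p ℓ q) (dab dac dbc : Fin q → ZMod p) (w : ι → Vec p n)
    (x h₁ h₂ h₃ u v : ι) :
    B.IsSplit da db dab dac dbc (w x, w h₁, w h₂, w h₃) (w u, w v) ↔
      (∀ t, B.betaL (w (![u, v] t)) = (![da.1, db.1] : Fin 2 → _) t) ∧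
      ∀ t, B.betaQ (w (splitPairs x h₁ h₂ h₃ u v t).1) (w (splitPairs x h₁ h₂ h₃ u v t).2) +
        splitCoeff p t •
          B.betaQ (w (splitPairs x h₁ h₂ h₃ u v t).2) (w (splitPairs x h₁ h₂ h₃ u v t).2) =
          splitValue da db dab dac dbc t := by
  simp [IsSplit, splitPairs, splitCoeff, splitValue, Fin.forall_fin_succ]

lemma isCube_and_isSplit_iff (b da db : Label p ℓ q) (dab dac dbc : Fin q → ZMod p)
    (w : ι → Vec p n) (x h₁ h₂ h₃ u v : ι) :
    B.IsCube b (w x, w h₁, w h₂, w h₃) ∧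
        B.IsSplit da db dab dac dbc (w x, w h₁, w h₂, w h₃) (w u, w v) ↔
      (∀ t, B.betaL (w (Sum.elim ![x, h₁, h₂, h₃] ![u, v] t)) =
        Sum.elim (![b.1, 0, 0, 0] : Fin 4 → _) (![da.1, db.1] : Fin 2 → _) t) ∧
      ∀ t, B.betaQ (w (Sum.elim (cubePairs x h₁ h₂ h₃) (splitPairs x h₁ h₂ h₃ u v) t).1)
          (w (Sum.elim (cubePairs x h₁ h₂ h₃) (splitPairs x h₁ h₂ h₃ u v) t).2) +
        Sum.elim (cubeCoeff p) (splitCoeff p) t •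
          B.betaQ (w (Sum.elim (cubePairs x h₁ h₂ h₃) (splitPairs x h₁ h₂ h₃ u v) t).2)
            (w (Sum.elim (cubePairs x h₁ h₂ h₃) (splitPairs x h₁ h₂ h₃ u v) t).2) =
          Sum.elim (![b.2, 0, 0, 0, 0, 0, 0] : Fin 7 → _)
            (splitValue da db dab dac dbc) t := by
  rw [isCube_iff, isSplit_iff, Sum.forall, Sum.forall]
  exact and_and_and_comm

lemma isCube_and_isSplit_and_isSplit_iff (b da db : Label p ℓ q) (dab dac dbc : Fin q → ZMod p)
    (w : ι → Vec p n) (x h₁ h₂ h₃ u v u' v' : ι) :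
    B.IsCube b (w x, w h₁, w h₂, w h₃) ∧
        B.IsSplit da db dab dac dbc (w x, w h₁, w h₂, w h₃) (w u, w v) ∧
        B.IsSplit da db dab dac dbc (w x, w h₁, w h₂, w h₃) (w u', w v') ↔
      (∀ t, B.betaL (w (Sum.elim ![x, h₁, h₂, h₃] (Sum.elim ![u, v] ![u', v']) t)) =
        Sum.elim (![b.1, 0, 0, 0] : Fin 4 → _)
          (Sum.elim (![da.1, db.1] : Fin 2 → _) (![da.1, db.1] : Fin 2 → _)) t) ∧
      ∀ t, B.betaQ (w (Sum.elim (cubePairs x h₁ h₂ h₃) (Sum.elim (splitPairs x h₁ h₂ h₃ u v)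
            (splitPairs x h₁ h₂ h₃ u' v')) t).1)
          (w (Sum.elim (cubePairs x h₁ h₂ h₃) (Sum.elim (splitPairs x h₁ h₂ h₃ u v)
            (splitPairs x h₁ h₂ h₃ u' v')) t).2) +
        Sum.elim (cubeCoeff p) (Sum.elim (splitCoeff p) (splitCoeff p)) t •
          B.betaQ (w (Sum.elim (cubePairs x h₁ h₂ h₃) (Sum.elim (splitPairs x h₁ h₂ h₃ u v)
              (splitPairs x h₁ h₂ h₃ u' v')) t).2)
            (w (Sum.elim (cubePairs x h₁ h₂ h₃) (Sum.elim (splitPairs x h₁ h₂ h₃ u v)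
              (splitPairs x h₁ h₂ h₃ u' v')) t).2) =
          Sum.elim (![b.2, 0, 0, 0, 0, 0, 0] : Fin 7 → _)
            (Sum.elim (splitValue da db dab dac dbc) (splitValue da db dab dac dbc)) t := by
  rw [isCube_iff, isSplit_iff, isSplit_iff, Sum.forall, Sum.forall, Sum.forall, Sum.forall]
  exact (and_congr_right' and_and_and_comm).trans and_and_and_comm

end Forms

lemma abs_card_isCube_sub_le [NeZero p] [Fact p.Prime] (hp : p ≠ 2) (b : Label p ℓ q) {D : ℕ}
    (hD : 29 * (ℓ + q) ≤ D) :
    |((univ.filter fun w => B.IsCube b w).card : ℝ) - (p : ℝ) ^ (n * 4) / p ^ (4 * ℓ + 7 * q)| ≤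
      B.countError D * ((p : ℝ) ^ (n * 4) / p ^ (4 * ℓ + 7 * q)) := by
  have h := B.abs_card_config_sub_le hp (τ := (![0, 1, 2, 3] : Fin 4 → Fin 4)) (by decide)
    (s := cubePairs 0 1 2 3) (by decide) (e := cubeCoeff p)
    (fun t => by fin_cases t <;> simp [cubePairs, cubeCoeff]) ![b.1, 0, 0, 0]
    ![b.2, 0, 0, 0, 0, 0, 0] (D := D) (by simp only [Fintype.card_fin]; omega)
  simp only [Fintype.card_fin, ← isCube_iff] at h
  rwa [Finset.card_nbij' (t := univ.filter fun w => B.IsCube b w) (fun v => (v 0, v 1, v 2, v 3))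
    (fun w => ![w.1, w.2.1, w.2.2.1, w.2.2.2])] at h
  · intro v hv
    simpa using hv
  · intro w hw
    simpa using hw
  · intro v _
    funext i
    fin_cases i <;> rfl
  · intro w _
    rfl

lemma abs_card_isSplit_sub_le [NeZero p] [Fact p.Prime] (hp : p ≠ 2) (b da db : Label p ℓ q)
    (dab dac dbc : Fin q → ZMod p) {D : ℕ} (hD : 29 * (ℓ + q) ≤ D) :
    |((univ.filter fun w : (Vec p n × Vec p n × Vec p n × Vec p n) × Vec p n × Vec p n =>
        B.IsCube b w.1 ∧ B.IsSplit da db dab dac dbc w.1 w.2).card : ℝ) -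
        (p : ℝ) ^ (n * 6) / p ^ (6 * ℓ + 18 * q)| ≤
      B.countError D * ((p : ℝ) ^ (n * 6) / p ^ (6 * ℓ + 18 * q)) := by
  have h := B.abs_card_config_sub_le hp
    (τ := Sum.elim (![0, 1, 2, 3] : Fin 4 → Fin 6) ![4, 5]) (by decide)
    (s := Sum.elim (cubePairs 0 1 2 3) (splitPairs 0 1 2 3 4 5)) (by decide)
    (e := Sum.elim (cubeCoeff p) (splitCoeff p))
    (by rintro (t | t) <;> fin_cases t <;> simp [cubePairs, cubeCoeff, splitPairs, splitCoeff])
    (Sum.elim ![b.1, 0, 0, 0] ![da.1, db.1])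
    (Sum.elim ![b.2, 0, 0, 0, 0, 0, 0] (splitValue da db dab dac dbc)) (D := D)
    (by simp only [Fintype.card_fin, Fintype.card_sum]; omega)
  simp only [Fintype.card_fin, Fintype.card_sum, ← isCube_and_isSplit_iff, Nat.reduceAdd] at h
  rwa [Finset.card_nbij' (t := univ.filter fun w :
      (Vec p n × Vec p n × Vec p n × Vec p n) × Vec p n × Vec p n =>
        B.IsCube b w.1 ∧ B.IsSplit da db dab dac dbc w.1 w.2)
    (fun v => ((v 0, v 1, v 2, v 3), v 4, v 5))
    (fun w => ![w.1.1, w.1.2.1, w.1.2.2.1, w.1.2.2.2, w.2.1, w.2.2])] at h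
  · intro v hv
    simpa using hv
  · intro w hw
    simpa using hw
  · intro v _
    funext i
    fin_cases i <;> rfl
  · intro w _
    rfl

lemma abs_card_isSplit_isSplit_sub_le [NeZero p] [Fact p.Prime] (hp : p ≠ 2)
    (b da db : Label p ℓ q) (dab dac dbc : Fin q → ZMod p) {D : ℕ} (hD : 29 * (ℓ + q) ≤ D) :
    |((univ.filter fun w : (Vec p n × Vec p n × Vec p n × Vec p n) × (Vec p n × Vec p n) ×
        Vec p n × Vec p n => B.IsCube b w.1 ∧ B.IsSplit da db dab dac dbc w.1 w.2.1 ∧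
          B.IsSplit da db dab dac dbc w.1 w.2.2).card : ℝ) -
        (p : ℝ) ^ (n * 8) / p ^ (8 * ℓ + 29 * q)| ≤
      B.countError D * ((p : ℝ) ^ (n * 8) / p ^ (8 * ℓ + 29 * q)) := by
  have h := B.abs_card_config_sub_le hp
    (τ := Sum.elim (![0, 1, 2, 3] : Fin 4 → Fin 8) (Sum.elim ![4, 5] ![6, 7])) (by decide)
    (s := Sum.elim (cubePairs 0 1 2 3)
      (Sum.elim (splitPairs 0 1 2 3 4 5) (splitPairs 0 1 2 3 6 7)))
    (by rintro (t | t | t) (t' | t' | t') <;> revert t t' <;> decide)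
    (e := Sum.elim (cubeCoeff p) (Sum.elim (splitCoeff p) (splitCoeff p)))
    (by rintro (t | t | t) <;> fin_cases t <;>
      simp [cubePairs, cubeCoeff, splitPairs, splitCoeff])
    (Sum.elim ![b.1, 0, 0, 0] (Sum.elim ![da.1, db.1] ![da.1, db.1]))
    (Sum.elim ![b.2, 0, 0, 0, 0, 0, 0] (Sum.elim (splitValue da db dab dac dbc)
      (splitValue da db dab dac dbc))) (D := D)
    (by simp only [Fintype.card_fin, Fintype.card_sum]; omega)
  simp only [Fintype.card_fin, Fintype.card_sum, ← isCube_and_isSplit_and_isSplit_iff,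
    Nat.reduceAdd] at h
  rwa [Finset.card_nbij' (t := univ.filter fun w :
      (Vec p n × Vec p n × Vec p n × Vec p n) × (Vec p n × Vec p n) × Vec p n × Vec p n =>
        B.IsCube b w.1 ∧ B.IsSplit da db dab dac dbc w.1 w.2.1 ∧
          B.IsSplit da db dab dac dbc w.1 w.2.2)
    (fun v => ((v 0, v 1, v 2, v 3), (v 4, v 5), v 6, v 7))
    (fun w => ![w.1.1, w.1.2.1, w.1.2.2.1, w.1.2.2.2, w.2.1.1, w.2.1.2, w.2.2.1, w.2.2.2])] at h
  · intro v hv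
    simpa using hv
  · intro w hw
    simpa using hw
  · intro v _
    funext i
    fin_cases i <;> rfl
  · intro w _
    rfl

lemma abs_ncard_atom_sub_le [NeZero p] [Fact p.Prime] (hp : p ≠ 2) (b : Label p ℓ q) {D : ℕ}
    (hD : 29 * (ℓ + q) ≤ D) :
    |((B.atom b).ncard : ℝ) - (p : ℝ) ^ n / p ^ (ℓ + q)| ≤
      B.countError D * ((p : ℝ) ^ n / p ^ (ℓ + q)) := by
  have h := B.abs_card_config_sub_le hp (τ := (id : Fin 1 → Fin 1)) (by decide)
    (s := fun _ : Fin 1 => (0, 0)) (by decide) (e := 0) (by simp) (fun _ => b.1)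
    (fun _ => b.2) (D := D) (by simp only [Fintype.card_fin]; omega)
  have hcard : (univ.filter fun v : Fin 1 → Vec p n => B.betaL (v 0) = b.1 ∧
      B.betaQ (v 0) (v 0) = b.2).card = (B.atom b).ncard := by
    rw [Set.ncard_eq_toFinset_card']
    refine Finset.card_nbij' (fun v => v 0) (fun x _ => x) ?_ ?_ ?_ ?_
    · intro v hv
      simpa [mem_atom_iff] using hv
    · intro v hv
      simpa [mem_atom_iff] using hv
    · intro v _
      funext i
      rw [Subsingleton.elim i 0]
    · intro v _
      rfl
  simpa [hcard] using h

lemma mem_fibQ_iff (d : Fin q → ZMod p) (x : Vec p n × Vec p n) :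
    x ∈ B.fibQ d ↔ B.betaQ x.1 x.2 = d :=
  Iff.rfl

lemma abs_ncard_fibQ_sub_le [NeZero p] [Fact p.Prime] (hp : p ≠ 2) (d : Fin q → ZMod p) {D : ℕ}
    (hD : 29 * (ℓ + q) ≤ D) :
    |((B.fibQ d).ncard : ℝ) - (p : ℝ) ^ (n * 2) / p ^ q| ≤
      B.countError D * ((p : ℝ) ^ (n * 2) / p ^ q) := by
  have h := B.abs_card_config_sub_le hp (τ := (Fin.elim0 : Fin 0 → Fin 2)) (by decide)
    (s := fun _ : Fin 1 => (0, 1)) (by decide) (e := 0) (by simp) Fin.elim0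
    (fun _ => d) (D := D) (by simp only [Fintype.card_fin]; omega)
  have hcard : (univ.filter fun v : Fin 2 → Vec p n => B.betaQ (v 0) (v 1) = d).card =
      (B.fibQ d).ncard := by
    rw [Set.ncard_eq_toFinset_card']
    refine Finset.card_nbij' (fun v => (v 0, v 1)) (fun x => ![x.1, x.2]) ?_ ?_ ?_ ?_
    · intro v hv
      simpa [mem_fibQ_iff] using hv
    · intro v hv
      simpa [mem_fibQ_iff] using hv
    · intro v _
      funext i
      fin_cases i <;> rfl
    · intro v _
      rfl
  simpa [hcard] using h

end QuadFactor

/-- If `c` has mean approximately `m` and second moment approximately `m ^ 2` on `s`, then the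
weight `c / m` is negligible when averaging bounded functions over `s`. -/
lemma abs_weighted_sum_sub_average_le {α : Type*} (s : Finset α) (c F : α → ℝ)
    {O m η κ W : ℝ} (hO : 0 < O) (hm : 0 < m) (hη₁ : η < 1) (hκ : κ ≤ 1)
    (hF : ∀ w ∈ s, |F w| ≤ 1) (hs : |(s.card : ℝ) - O| ≤ η * O)
    (hc : |∑ w ∈ s, c w - O * m| ≤ η * (O * m))
    (hc₂ : |∑ w ∈ s, c w ^ 2 - O * m ^ 2| ≤ η * (O * m ^ 2)) (hW : |W * (O * m) - 1| ≤ κ) :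
    |W * ∑ w ∈ s, c w * F w - (∑ w ∈ s, F w) / s.card| ≤ 6 * Real.sqrt η + 2 * κ + η := by
  have hη : 0 ≤ η := by
    by_contra! h
    exact absurd ((abs_nonneg _).trans hs) (not_le.mpr (mul_neg_of_neg_of_pos h hO))
  have hκ0 : 0 ≤ κ := (abs_nonneg _).trans hW
  rw [abs_le] at hs hc hc₂
  have hcard : (0 : ℝ) < s.card := by nlinarith
  have hvar : ∑ w ∈ s, (c w - m) ^ 2 ≤ 4 * η * (O * m ^ 2) := by
    have : ∑ w ∈ s, (c w - m) ^ 2 = ∑ w ∈ s, c w ^ 2 - 2 * m * ∑ w ∈ s, c w + m ^ 2 * s.card := by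
      rw [mul_sum, ← sum_sub_distrib, mul_comm (m ^ 2), ← nsmul_eq_mul, ← sum_const,
        ← sum_add_distrib]
      exact sum_congr rfl fun w _ => by ring
    rw [this]
    nlinarith [mul_le_mul_of_nonneg_left hc.1 (by positivity : 0 ≤ 2 * m),
      mul_le_mul_of_nonneg_left hs.2 (by positivity : 0 ≤ m ^ 2)]
  have hFsq : ∑ w ∈ s, F w ^ 2 ≤ 2 * O := by
    calc ∑ w ∈ s, F w ^ 2 ≤ ∑ w ∈ s, 1 :=
          sum_le_sum fun w hw => (sq_le_one_iff_abs_le_one _).mpr (hF w hw)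
      _ = s.card := by simp
      _ ≤ 2 * O := by nlinarith
  have hdev : |∑ w ∈ s, (c w - m) * F w| ≤ 3 * Real.sqrt η * (O * m) := by
    refine abs_le_of_sq_le_sq ?_ (by positivity)
    calc (∑ w ∈ s, (c w - m) * F w) ^ 2
        ≤ (∑ w ∈ s, (c w - m) ^ 2) * ∑ w ∈ s, F w ^ 2 := sum_mul_sq_le_sq_mul_sq _ _ _
      _ ≤ 4 * η * (O * m ^ 2) * (2 * O) := by gcongr
      _ ≤ 9 * η * (O * m) ^ 2 := by nlinarith [mul_nonneg hη (sq_nonneg (O * m))]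
      _ = (3 * Real.sqrt η * (O * m)) ^ 2 := by
        rw [mul_pow _ (O * m), mul_pow 3, Real.sq_sqrt hη]
        norm_num
  have hsum : |(∑ w ∈ s, F w) / s.card| ≤ 1 := by
    rw [abs_div, abs_of_pos hcard, div_le_one hcard]
    calc |∑ w ∈ s, F w| ≤ ∑ w ∈ s, |F w| := abs_sum_le_sum_abs _ _
      _ ≤ ∑ w ∈ s, 1 := sum_le_sum hF
      _ = s.card := by simp
  have hsplit : W * ∑ w ∈ s, c w * F w - (∑ w ∈ s, F w) / s.card =
      (W * (O * m)) * ((∑ w ∈ s, (c w - m) * F w) / (O * m)) +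
        (W * (O * m) * (s.card / O) - 1) * ((∑ w ∈ s, F w) / s.card) := by
    simp only [sub_mul, sum_sub_distrib, ← mul_sum]
    field_simp
    ring
  have hratio : |(s.card : ℝ) / O - 1| ≤ η := by
    rw [div_sub_one hO.ne', abs_div, abs_of_pos hO, div_le_iff₀ hO]
    exact abs_le.mpr hs
  have hW₂ : |W * (O * m)| ≤ 2 := by
    rw [abs_le] at hW ⊢
    constructor <;> linarith
  have hdev' : |(∑ w ∈ s, (c w - m) * F w) / (O * m)| ≤ 3 * Real.sqrt η := by
    rwa [abs_div, abs_of_pos (mul_pos hO hm), div_le_iff₀ (mul_pos hO hm)]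
  have hfactor : |W * (O * m) * (s.card / O) - 1| ≤ 2 * κ + η := by
    have : W * (O * m) * (s.card / O) - 1 =
        (W * (O * m) - 1) * (s.card / O) + (s.card / O - 1) := by ring
    rw [this]
    have h₂ : |(s.card : ℝ) / O| ≤ 2 := by
      rw [abs_le] at hratio ⊢
      constructor <;> linarith
    calc _ ≤ |W * (O * m) - 1| * |(s.card : ℝ) / O| + |(s.card : ℝ) / O - 1| := by
          rw [← abs_mul]; exact abs_add_le _ _
      _ ≤ κ * 2 + η := by gcongr
      _ = 2 * κ + η := by ring
  rw [hsplit]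
  calc _ ≤ |W * (O * m)| * |(∑ w ∈ s, (c w - m) * F w) / (O * m)| +
        |W * (O * m) * (s.card / O) - 1| * |(∑ w ∈ s, F w) / s.card| := by
        rw [← abs_mul, ← abs_mul]; exact abs_add_le _ _
    _ ≤ 2 * (3 * Real.sqrt η) + (2 * κ + η) * 1 := by gcongr
    _ = _ := by ring

lemma abs_inv_mul_inv_sub_one_le {η α₁ α₂ α₃ γ₁ γ₂ γ₃ : ℝ} (hη : η ≤ 1 / 1000)
    (h₁ : |α₁ - 1| ≤ η) (h₂ : |α₂ - 1| ≤ η) (h₃ : |α₃ - 1| ≤ η) (h₄ : |γ₁ - 1| ≤ η)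
    (h₅ : |γ₂ - 1| ≤ η) (h₆ : |γ₃ - 1| ≤ η) :
    |(α₁ ^ 2 * α₂ ^ 2 * α₃ ^ 2 * γ₁ ^ 4 * γ₂ ^ 4 * γ₃ ^ 4)⁻¹ - 1| ≤ 36 * η := by
  have hη0 : 0 ≤ η := (abs_nonneg _).trans h₁
  rw [abs_le] at h₁ h₂ h₃ h₄ h₅ h₆
  have hlow : 1 - 18 * η ≤ (1 - η) ^ 18 := by
    have := one_add_mul_le_pow (a := -η) (by linarith) 18
    norm_num at this
    linarith
  set P := α₁ ^ 2 * α₂ ^ 2 * α₃ ^ 2 * γ₁ ^ 4 * γ₂ ^ 4 * γ₃ ^ 4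
  have hge : (1 - η) ^ 18 ≤ P := by
    have h0 : 0 ≤ 1 - η := by linarith
    calc (1 - η) ^ 18 = (1 - η) ^ 2 * (1 - η) ^ 2 * (1 - η) ^ 2 * (1 - η) ^ 4 * (1 - η) ^ 4 *
          (1 - η) ^ 4 := by ring
      _ ≤ P := by
        simp only [P]
        gcongr <;> linarith
  have hle : P ≤ (1 + η) ^ 18 := by
    have a₁ : 0 ≤ α₁ := by linarith
    have a₂ : 0 ≤ α₂ := by linarith
    have a₃ : 0 ≤ α₃ := by linarith
    have a₄ : 0 ≤ γ₁ := by linarith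
    have a₅ : 0 ≤ γ₂ := by linarith
    have a₆ : 0 ≤ γ₃ := by linarith
    calc P ≤ (1 + η) ^ 2 * (1 + η) ^ 2 * (1 + η) ^ 2 * (1 + η) ^ 4 * (1 + η) ^ 4 *
          (1 + η) ^ 4 := by
          simp only [P]
          gcongr <;> linarith
      _ = (1 + η) ^ 18 := by ring
  have hprod : P * (1 - 18 * η) ≤ 1 := by
    calc P * (1 - 18 * η) ≤ (1 + η) ^ 18 * (1 - η) ^ 18 := by
          apply mul_le_mul hle hlow (by linarith) (by positivity)
      _ = (1 - η ^ 2) ^ 18 := by rw [← mul_pow]; ring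
      _ ≤ 1 := pow_le_one₀ (by nlinarith) (by nlinarith)
  have hP : 0 < P := by linarith
  rw [abs_le]
  constructor
  · have : 1 - 18 * η ≤ P⁻¹ := by
      rw [← one_div, le_div_iff₀ hP, mul_comm]
      exact hprod
    linarith
  · have : P⁻¹ ≤ 1 + 36 * η := by
      rw [inv_le_iff_one_le_mul₀ hP]
      nlinarith
    linarith

section Norms

variable {G : Type*}

lemma ind1_eq_ite (S : Set G) (x : G) : ind1 S x = if x ∈ S then 1 else 0 :=
  Set.indicator_apply S 1 x

lemma expOver_eq [Fintype G] (S : Set G) (g : G → ℝ) :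
    expOver S g = ∑ x, (S.ncard : ℝ)⁻¹ * ind1 S x * g x := by
  simp only [expOver, setSum, ind1_eq_ite, sum_filter, div_eq_inv_mul, mul_sum]
  exact sum_congr rfl fun x _ => by split_ifs <;> ring

variable [AddCommGroup G]

/-- The parametrisation of `G ^ 6` by a cube together with the first two of three summands. -/
def splitEquiv (G : Type*) [AddCommGroup G] :
    (G × G × G × G) × G × G ≃ G × G × G × G × G × G where
  toFun t := (t.2.1, t.2.1 + t.1.2.1, t.2.2, t.2.2 + t.1.2.2.1, t.1.1 - t.2.1 - t.2.2,
    t.1.1 - t.2.1 - t.2.2 + t.1.2.2.2)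
  invFun t := ((t.1 + t.2.2.1 + t.2.2.2.2.1, t.2.1 - t.1, t.2.2.2.1 - t.2.2.1,
    t.2.2.2.2.2 - t.2.2.2.2.1), t.1, t.2.2.1)
  left_inv t := by
    ext <;> simp
  right_inv t := by
    ext <;> simp <;> abel

lemma prod8_splitEquiv (f : G → ℝ) (w : G × G × G × G) (u : G × G) :
    prod8 f (splitEquiv G (w, u)) = cubeProd f w.1 w.2.1 w.2.2.1 w.2.2.2 := by
  obtain ⟨x, h₁, h₂, h₃⟩ := w
  obtain ⟨u, v⟩ := u
  simp only [prod8, splitEquiv, Equiv.coe_fn_mk, cubeProd]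
  rw [show u + v + (x - u - v) = x by abel, show u + v + (x - u - v + h₃) = x + h₃ by abel,
    show u + (v + h₂) + (x - u - v) = x + h₂ by abel,
    show u + (v + h₂) + (x - u - v + h₃) = x + h₂ + h₃ by abel,
    show u + h₁ + v + (x - u - v) = x + h₁ by abel,
    show u + h₁ + v + (x - u - v + h₃) = x + h₁ + h₃ by abel,
    show u + h₁ + (v + h₂) + (x - u - v) = x + h₁ + h₂ by abel,
    show u + h₁ + (v + h₂) + (x - u - v + h₃) = x + h₁ + h₂ + h₃ by abel]
  ring

variable [Fintype G]

lemma U3pow8_nonneg (f : G → ℝ) : 0 ≤ U3pow8 f := by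
  have h : U3pow8 f =
      ∑ h₁, ∑ h₂, (∑ x, f x * f (x + h₁) * f (x + h₂) * f (x + h₁ + h₂)) ^ 2 := by
    rw [U3pow8, sum_comm]
    refine sum_congr rfl fun h₁ _ => ?_
    rw [sum_comm]
    refine sum_congr rfl fun h₂ _ => ?_
    rw [sq, sum_mul]
    refine sum_congr rfl fun x _ => ?_
    rw [mul_sum]
    refine Fintype.sum_equiv (Equiv.addLeft x) _ _ fun h₃ => ?_
    simp only [cubeProd, Equiv.coe_addLeft, add_right_comm _ h₃]
    ring
  rw [h]
  positivity

lemma U3pow8_mul_ind1 (f : G → ℝ) (S : Set G) :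
    U3pow8 (fun x => f x * ind1 S x) =
      ∑ w ∈ univ.filter (fun w => w ∈ Omega S), cubeProd f w.1 w.2.1 w.2.2.1 w.2.2.2 := by
  simp only [U3pow8, sum_filter, Fintype.sum_prod_type]
  refine sum_congr rfl fun x _ => sum_congr rfl fun h₁ _ => sum_congr rfl fun h₂ _ =>
    sum_congr rfl fun h₃ _ => ?_
  have hΩ : (if (x, h₁, h₂, h₃) ∈ Omega S then (1 : ℝ) else 0) =
      ind1 S x * (ind1 S (x + h₁) * (ind1 S (x + h₂) * (ind1 S (x + h₃) * (ind1 S (x + h₁ + h₂) *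
        (ind1 S (x + h₁ + h₃) * (ind1 S (x + h₂ + h₃) * ind1 S (x + h₁ + h₂ + h₃))))))) := by
    simp only [ind1_eq_ite, ite_zero_mul_ite_zero, mul_one]
    exact if_congr Iff.rfl rfl rfl
  rw [← mul_boole, hΩ]
  simp only [cubeProd]
  ring

lemma U3localP_pow_eight (f : G → ℝ) (S : Set G) :
    U3localP f S ^ 8 =
      (∑ w ∈ univ.filter (fun w => w ∈ Omega S), cubeProd f w.1 w.2.1 w.2.2.1 w.2.2.2) /
        (univ.filter fun w => w ∈ Omega S).card := by
  have hpow (g : G → ℝ) : U3norm g ^ 8 = U3pow8 g := by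
    rw [U3norm, ← Real.rpow_natCast, ← Real.rpow_mul (U3pow8_nonneg g)]
    norm_num
  have hone : U3pow8 (ind1 S) = (univ.filter fun w => w ∈ Omega S).card := by
    have h := U3pow8_mul_ind1 (fun _ => 1) S
    simpa [cubeProd] using h
  rw [U3localP, div_pow, hpow, hpow, U3pow8_mul_ind1, hone]

end Norms

section TerryWolf

variable {p n ℓ q : ℕ} [NeZero p] (B : QuadFactor p n ℓ q) (f : Vec p n → ℝ)
  (da db dc : Label p ℓ q) (dab dac dbc : Fin q → ZMod p)

/-- The total normalisation of the Terry–Wolf norm. -/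
noncomputable def twWeight : ℝ :=
  (((B.atom da).ncard : ℝ) ^ 2 * ((B.atom db).ncard : ℝ) ^ 2 * ((B.atom dc).ncard : ℝ) ^ 2)⁻¹ *
    (((Fintype.card (Vec p n) : ℝ) ^ 2 / (B.fibQ dab).ncard) ^ 4 *
      ((Fintype.card (Vec p n) : ℝ) ^ 2 / (B.fibQ dac).ncard) ^ 4 *
      ((Fintype.card (Vec p n) : ℝ) ^ 2 / (B.fibQ dbc).ncard) ^ 4)

lemma TW8_eq_sum_K222 :
    TW8 B f da db dc dab dac dbc = twWeight B da db dc dab dac dbc *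
      ∑ t ∈ univ.filter (fun t => t ∈ K222 B da db dc dab dac dbc), prod8 f t := by
  simp only [TW8, expOver_eq, sum_filter, mul_sum, Fintype.sum_prod_type]
  refine sum_congr rfl fun x₁ _ => sum_congr rfl fun x₂ _ => sum_congr rfl fun y₁ _ =>
    sum_congr rfl fun y₂ _ => sum_congr rfl fun z₁ _ => sum_congr rfl fun z₂ _ => ?_
  have hK : (if (x₁, x₂, y₁, y₂, z₁, z₂) ∈ K222 B da db dc dab dac dbc then (1 : ℝ) else 0) =
      ind1 (B.atom da) x₁ * (ind1 (B.atom da) x₂ * (ind1 (B.atom db) y₁ * (ind1 (B.atom db) y₂ *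
      (ind1 (B.atom dc) z₁ * (ind1 (B.atom dc) z₂ * (ind1 (B.fibQ dab) (x₁, y₁) *
      (ind1 (B.fibQ dab) (x₁, y₂) * (ind1 (B.fibQ dab) (x₂, y₁) * (ind1 (B.fibQ dab) (x₂, y₂) *
      (ind1 (B.fibQ dac) (x₁, z₁) * (ind1 (B.fibQ dac) (x₁, z₂) * (ind1 (B.fibQ dac) (x₂, z₁) *
      (ind1 (B.fibQ dac) (x₂, z₂) * (ind1 (B.fibQ dbc) (y₁, z₁) * (ind1 (B.fibQ dbc) (y₁, z₂) *
      (ind1 (B.fibQ dbc) (y₂, z₁) * ind1 (B.fibQ dbc) (y₂, z₂))))))))))))))))) := by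
    simp only [ind1_eq_ite, ite_zero_mul_ite_zero, mul_one]
    exact if_congr Iff.rfl rfl rfl
  rw [← mul_boole, hK]
  simp only [mu, twWeight]
  ring

variable {da db dc dab dac dbc}

lemma TW8_eq_sum_isCube [Fact p.Prime] (hp : p ≠ 2) :
    TW8 B f da db dc dab dac dbc = twWeight B da db dc dab dac dbc *
      ∑ w ∈ univ.filter (fun w => B.IsCube (SigmaD da db dc dab dac dbc) w),
        ((univ.filter fun u => B.IsSplit da db dab dac dbc w u).card : ℝ) *
          cubeProd f w.1 w.2.1 w.2.2.1 w.2.2.2 := by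
  rw [TW8_eq_sum_K222, sum_filter, ← Equiv.sum_comp (splitEquiv (Vec p n)),
    Fintype.sum_prod_type, sum_filter]
  congr 1
  refine sum_congr rfl fun w _ => ?_
  have hmem (u : Vec p n × Vec p n) :
      splitEquiv (Vec p n) (w, u) ∈ K222 B da db dc dab dac dbc ↔
        B.IsCube (SigmaD da db dc dab dac dbc) w ∧ B.IsSplit da db dab dac dbc w u :=
    B.mem_K222_iff hp da db dc dab dac dbc _ _ _ _ _ _
  simp only [prod8_splitEquiv, hmem, ite_and]
  split_ifs
  · rw [← sum_filter, sum_const, nsmul_eq_mul]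
  · simp

end TerryWolf

lemma abs_cubeProd_le {G : Type*} [AddCommGroup G] {f : G → ℝ} (hf : ∀ x, |f x| ≤ 1)
    (x h₁ h₂ h₃ : G) : |cubeProd f x h₁ h₂ h₃| ≤ 1 := by
  simp only [cubeProd, abs_mul]
  repeat' refine mul_le_one₀ ?_ (abs_nonneg _) (hf _)
  exact hf _

lemma sum_card_filter {α β : Type*} [Fintype α] [Fintype β] (P : α → Prop) (R : α → β → Prop)
    [DecidablePred P] [∀ w, DecidablePred (R w)]
    [DecidablePred fun w : α × β => P w.1 ∧ R w.1 w.2] :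
    ∑ w ∈ univ.filter P, (univ.filter (R w)).card =
      (univ.filter fun w : α × β => P w.1 ∧ R w.1 w.2).card := by
  rw [card_filter, Fintype.sum_prod_type, sum_filter]
  refine sum_congr rfl fun w _ => ?_
  by_cases h : P w <;> simp [h]

lemma sum_card_filter_sq {α β : Type*} [Fintype α] [Fintype β] (P : α → Prop)
    (R : α → β → Prop) [DecidablePred P] [∀ w, DecidablePred (R w)]
    [DecidablePred fun w : α × β × β => P w.1 ∧ R w.1 w.2.1 ∧ R w.1 w.2.2] :
    ∑ w ∈ univ.filter P, (univ.filter (R w)).card ^ 2 =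
      (univ.filter fun w : α × β × β => P w.1 ∧ R w.1 w.2.1 ∧ R w.1 w.2.2).card := by
  refine Eq.trans (sum_congr rfl fun w _ => ?_)
    (sum_card_filter P fun w (u : β × β) => R w u.1 ∧ R w u.2)
  rw [← univ_product_univ, filter_product, card_product, sq]

lemma abs_TW8_sub_U3localP_le {p n ℓ q : ℕ} [NeZero p] [Fact p.Prime] (hp : p ≠ 2)
    (B : QuadFactor p n ℓ q) (hB : B.countError (29 * (ℓ + q)) ≤ 1 / 1000)
    {f : Vec p n → ℝ} (hf : ∀ x, |f x| ≤ 1) (da db dc : Label p ℓ q)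
    (dab dac dbc : Fin q → ZMod p) :
    |TW8 B f da db dc dab dac dbc -
        U3localP f (B.atom (SigmaD da db dc dab dac dbc)) ^ 8| ≤
      79 * Real.sqrt (B.countError (29 * (ℓ + q))) := by
  set b := SigmaD da db dc dab dac dbc
  have hp0 : (0 : ℝ) < p := by exact_mod_cast Nat.pos_of_neZero p
  have hO : 0 < (p : ℝ) ^ (n * 4) / p ^ (4 * ℓ + 7 * q) := by positivity
  have hm : 0 < (p : ℝ) ^ (n * 2) / p ^ (2 * ℓ + 11 * q) := by positivity
  have hOm : (p : ℝ) ^ (n * 4) / p ^ (4 * ℓ + 7 * q) * (p ^ (n * 2) / p ^ (2 * ℓ + 11 * q)) =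
      p ^ (n * 6) / p ^ (6 * ℓ + 18 * q) := by
    rw [div_mul_div_comm, ← pow_add, ← pow_add]
    congr 2 <;> ring
  have hOm₂ : (p : ℝ) ^ (n * 4) / p ^ (4 * ℓ + 7 * q) *
      (p ^ (n * 2) / p ^ (2 * ℓ + 11 * q)) ^ 2 = p ^ (n * 8) / p ^ (8 * ℓ + 29 * q) := by
    rw [div_pow, div_mul_div_comm, ← pow_mul, ← pow_mul, ← pow_add, ← pow_add]
    congr 2 <;> ring
  have hcount₁ : ∑ w ∈ univ.filter (fun w => B.IsCube b w),
      ((univ.filter fun u => B.IsSplit da db dab dac dbc w u).card : ℝ) =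
      (univ.filter fun w : (Vec p n × Vec p n × Vec p n × Vec p n) × Vec p n × Vec p n =>
        B.IsCube b w.1 ∧ B.IsSplit da db dab dac dbc w.1 w.2).card := by
    rw [← sum_card_filter, Nat.cast_sum]
  have hcount₂ : ∑ w ∈ univ.filter (fun w => B.IsCube b w),
      ((univ.filter fun u => B.IsSplit da db dab dac dbc w u).card : ℝ) ^ 2 =
      (univ.filter fun w : (Vec p n × Vec p n × Vec p n × Vec p n) × (Vec p n × Vec p n) ×
        Vec p n × Vec p n => B.IsCube b w.1 ∧ B.IsSplit da db dab dac dbc w.1 w.2.1 ∧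
          B.IsSplit da db dab dac dbc w.1 w.2.2).card := by
    rw [← sum_card_filter_sq, Nat.cast_sum]
    simp only [Nat.cast_pow]
  have hα (d : Label p ℓ q) : |((B.atom d).ncard : ℝ) / (p ^ n / p ^ (ℓ + q)) - 1| ≤
      B.countError (29 * (ℓ + q)) := by
    have h0 : 0 < (p : ℝ) ^ n / p ^ (ℓ + q) := by positivity
    rw [div_sub_one h0.ne', abs_div, abs_of_pos h0, div_le_iff₀ h0]
    exact B.abs_ncard_atom_sub_le hp d le_rfl
  have hγ (d : Fin q → ZMod p) : |((B.fibQ d).ncard : ℝ) / (p ^ (n * 2) / p ^ q) - 1| ≤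
      B.countError (29 * (ℓ + q)) := by
    have h0 : 0 < (p : ℝ) ^ (n * 2) / p ^ q := by positivity
    rw [div_sub_one h0.ne', abs_div, abs_of_pos h0, div_le_iff₀ h0]
    exact B.abs_ncard_fibQ_sub_le hp d le_rfl
  have hη := (abs_nonneg _).trans (hα da)
  have hW := abs_inv_mul_inv_sub_one_le hB (hα da) (hα db) (hα dc) (hγ dab) (hγ dac) (hγ dbc)
  have hWeq : twWeight B da db dc dab dac dbc *
      ((p : ℝ) ^ (n * 4) / p ^ (4 * ℓ + 7 * q) * (p ^ (n * 2) / p ^ (2 * ℓ + 11 * q))) =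
      ((((B.atom da).ncard : ℝ) / (p ^ n / p ^ (ℓ + q))) ^ 2 *
        (((B.atom db).ncard : ℝ) / (p ^ n / p ^ (ℓ + q))) ^ 2 *
        (((B.atom dc).ncard : ℝ) / (p ^ n / p ^ (ℓ + q))) ^ 2 *
        (((B.fibQ dab).ncard : ℝ) / (p ^ (n * 2) / p ^ q)) ^ 4 *
        (((B.fibQ dac).ncard : ℝ) / (p ^ (n * 2) / p ^ q)) ^ 4 *
        (((B.fibQ dbc).ncard : ℝ) / (p ^ (n * 2) / p ^ q)) ^ 4)⁻¹ := by
    rw [hOm, twWeight, Fintype.card_fun, ZMod.card, Fintype.card_fin]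
    push_cast
    simp only [pow_add, pow_mul', mul_pow, div_pow, mul_inv, inv_div]
    field_simp
    ring
  rw [← hWeq] at hW
  have key := abs_weighted_sum_sub_average_le (univ.filter fun w => B.IsCube b w)
    (fun w => ((univ.filter fun u => B.IsSplit da db dab dac dbc w u).card : ℝ))
    (fun w => cubeProd f w.1 w.2.1 w.2.2.1 w.2.2.2) hO hm (by linarith) (by linarith)
    (fun w _ => abs_cubeProd_le hf _ _ _ _) (B.abs_card_isCube_sub_le hp b le_rfl)
    (by rw [hcount₁, hOm]; exact B.abs_card_isSplit_sub_le hp b da db dab dac dbc le_rfl)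
    (by
      rw [hcount₂, hOm₂]
      exact B.abs_card_isSplit_isSplit_sub_le hp b da db dab dac dbc le_rfl) hW
  rw [TW8_eq_sum_isCube B f hp, U3localP_pow_eight]
  simp only [B.mem_Omega_atom_iff hp]
  refine key.trans ?_
  have hsqrt : B.countError (29 * (ℓ + q)) ≤ Real.sqrt (B.countError (29 * (ℓ + q))) :=
    Real.le_sqrt_of_sq_le (by nlinarith)
  linarith

lemma sqrt_div_sqrt_pow_le {x ε : ℝ} (hx : 3 ≤ x) (hε : 0 < ε) (hε₁ : ε < 1) {s r : ℕ}
    (hr : 200 * (s + Real.logb x ε⁻¹) ≤ r) :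
    (x ^ (29 * s) - 1) / Real.sqrt (x ^ r) ≤ 1 / 1000 ∧
      79 * Real.sqrt ((x ^ (29 * s) - 1) / Real.sqrt (x ^ r)) ≤ ε := by
  rcases Nat.eq_zero_or_pos s with rfl | hs
  · simp [hε.le]
  have hx0 : 0 < x := by linarith
  have hX : (x ^ s * ε⁻¹) ^ 200 ≤ x ^ r := by
    have hpow : x ^ s * ε⁻¹ = x ^ ((s : ℝ) + Real.logb x ε⁻¹) := by
      rw [Real.rpow_add hx0, Real.rpow_natCast, Real.rpow_logb hx0 (by linarith) (inv_pos.mpr hε)]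
    rw [hpow, ← Real.rpow_natCast x r, ← Real.rpow_mul_natCast hx0.le]
    refine Real.rpow_le_rpow_of_exponent_le (by linarith) ?_
    push_cast
    linarith
  set X := x ^ s * ε⁻¹ with hXdef
  have hxs : 3 ≤ x ^ s := hx.trans (le_self_pow₀ (by linarith) hs.ne')
  have hεinv : 1 ≤ ε⁻¹ := (one_le_inv₀ hε).mpr hε₁.le
  have hxX : x ^ s ≤ X := le_mul_of_one_le_right (by positivity) hεinv
  have hX3 : 3 ≤ X := hxs.trans hxX
  have hX0 : 0 < X := by linarith
  have hXε : X⁻¹ ≤ ε := by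
    rw [hXdef, mul_inv, inv_inv]
    exact mul_le_of_le_one_left hε.le (inv_le_one_of_one_le₀ (by linarith))
  have hη : (x ^ (29 * s) - 1) / Real.sqrt (x ^ r) ≤ (X⁻¹) ^ 71 := by
    have hsqrt : X ^ 100 ≤ Real.sqrt (x ^ r) := by
      refine Real.le_sqrt_of_sq_le ?_
      rwa [← pow_mul]
    calc _ ≤ X ^ 29 / X ^ 100 := by
          gcongr
          calc x ^ (29 * s) - 1 ≤ x ^ (29 * s) := by linarith
            _ = (x ^ s) ^ 29 := by rw [← pow_mul, mul_comm]
            _ ≤ X ^ 29 := by gcongr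
      _ = (X⁻¹) ^ 71 := by field_simp
  have hX3' : X⁻¹ ≤ 3⁻¹ := inv_anti₀ (by norm_num) hX3
  have hη' : (x ^ (29 * s) - 1) / Real.sqrt (x ^ r) ≤ (3⁻¹) ^ 69 * ε ^ 2 := by
    calc _ ≤ (X⁻¹) ^ 71 := hη
      _ = (X⁻¹) ^ 69 * (X⁻¹) ^ 2 := by ring
      _ ≤ _ := by gcongr
  constructor
  · refine hη.trans ((pow_le_pow_left₀ (by positivity) hX3' 71).trans (by norm_num))
  · have h : Real.sqrt ((x ^ (29 * s) - 1) / Real.sqrt (x ^ r)) ≤ ε / 79 := by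
      refine Real.sqrt_le_iff.mpr ⟨by positivity, hη'.trans ?_⟩
      rw [div_pow, div_eq_mul_inv, mul_comm]
      gcongr
      norm_num
    linarith

theorem statement2 :
    ∃ C > (0 : ℝ), ∀ (p : ℕ) [NeZero p], p.Prime → Odd p →
      ∀ ε : ℝ, 0 < ε → ε < 1 →
      ∀ (n ℓ q : ℕ) (B : QuadFactor p n ℓ q),
        C * ((ℓ : ℝ) + (q : ℝ) + Real.logb p ε⁻¹) ≤ (B.rank : ℝ) →
        ∀ (b da db dc : Label p ℓ q) (dab dac dbc : Fin q → ZMod p),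
          SigmaD da db dc dab dac dbc = b →
          ∀ f : Vec p n → ℝ, (∀ x, f x ∈ Set.Icc (-1 : ℝ) 1) →
            |TW8 B f da db dc dab dac dbc - U3localP f (B.atom b) ^ 8| ≤ ε := by
  refine ⟨200, by norm_num, ?_⟩
  intro p _ hprime hodd ε hε hε₁ n ℓ q B hB b da db dc dab dac dbc hb f hf
  subst hb
  have := Fact.mk hprime
  have hp : p ≠ 2 := by
    rintro rfl
    exact absurd hodd (by decide)
  have hp3 : (3 : ℝ) ≤ p := by
    exact_mod_cast (hprime.two_le.lt_of_ne' hp)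
  obtain ⟨h₁, h₂⟩ := sqrt_div_sqrt_pow_le (s := ℓ + q) hp3 hε hε₁ (by push_cast; exact hB)
  exact (abs_TW8_sub_U3localP_le hp B h₁ (fun x => abs_le.mpr (hf x)) da db dc dab dac dbc).trans h₂

end PaperTS
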